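/- Weighted interpolation against the boundary-adapted C̃^{1/2} norm: Let m ≥ 2 be an integer and σ_m > (m−2)/2 with m − 1/2 − σ_m − d/2 > 0. For 0 < j < m set θ_j = j/m, σ_j = σ_m θ_j − (1−θ_j)/2, 1/p_j = θ_j/2. Then there is a constant C such that for every f smooth on the closed half-space and compactly supported, ‖x_d^{σ_j} |∂^j f| ‖_{L^{p_j}(H)} ≤ C ‖f‖_{C̃^{1/2}}^{1−θ_j} ‖x_d^{σ_m} |∂^m f| ‖_{L^{2}(H)}^{θ_j}, where |∂^k f| denotes the norm of the full k-th derivative of f. -/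

import Mathlib

open MeasureTheory Set ENNReal

noncomputable section

/-- The half-space `H = {x ∈ ℝ^{d+1} : x_last > 0}`. -/
def HS (d : ℕ) : Set (Fin (d + 1) → ℝ) := {x | 0 < x (Fin.last d)}

/-- The weighted Lebesgue norm `‖x_d^σ g‖_{L^p(H)}`. -/
def wLp (d : ℕ) (σ : ℝ) (p : ℝ≥0∞) (g : (Fin (d + 1) → ℝ) → ℝ) : ℝ≥0∞ :=
  eLpNorm (fun x => x (Fin.last d) ^ σ * g x) p (volume.restrict (HS d))

theorem sum_neg_one_pow_card_of_subset {n : ℕ} (R : Finset (Fin n)) :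
    ∑ S : Finset (Fin n), (if R ⊆ S then (-1 : ℝ) ^ S.card else 0)
      = if R = Finset.univ then (-1 : ℝ) ^ n else 0 := by
  classical
  by_cases hR : R = Finset.univ
  · subst hR
    simp [Finset.univ_subset_iff]
  · rw [if_neg hR]
    obtain ⟨k, hk⟩ : ∃ k, k ∉ R := by
      by_contra! h
      exact hR (Finset.eq_univ_iff_forall.2 h)
    refine Finset.sum_involution (fun S _ => symmDiff S {k}) ?_ ?_ ?_ ?_
    · intro S _
      by_cases hkS : k ∈ S
      · have h1 : symmDiff S {k} = S.erase k := by
          ext x; simp [Finset.mem_symmDiff]; grind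
        have h2 : R ⊆ S.erase k ↔ R ⊆ S := by
          rw [Finset.subset_erase]; tauto
        have h3 := Finset.card_erase_add_one hkS
        simp only [h1, h2]
        split_ifs
        · rw [← h3]; ring
        · simp
      · have h1 : symmDiff S {k} = insert k S := by
          ext x; simp [Finset.mem_symmDiff]; grind
        have h2 : R ⊆ insert k S ↔ R ⊆ S := by
          rw [Finset.subset_insert_iff_of_notMem hk]
        simp only [h1, h2, Finset.card_insert_of_notMem hkS]
        split_ifs
        · ring
        · simp
    · intro S _ _ h
      simp at h
    · simp
    · intro S _
      simp

theorem symmetric_multilinear_polarization {E : Type*} [NormedAddCommGroup E] [NormedSpace ℝ E]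
    {n : ℕ} (A : ContinuousMultilinearMap ℝ (fun _ : Fin n => E) ℝ)
    (hA : ∀ (v : Fin n → E) (σ : Equiv.Perm (Fin n)), A (v ∘ σ) = A v)
    (w : E) (u : Fin n → E) :
    ∑ S : Finset (Fin n), (-1 : ℝ) ^ S.card * A (fun _ => w + ∑ i ∈ S, u i)
      = (-1 : ℝ) ^ n * (n.factorial * A u) := by
  classical
  let U : Option (Fin n) → E := fun k => k.elim w u
  let R : (Fin n → Option (Fin n)) → Finset (Fin n) :=
    fun r => Finset.univ.filter (fun k => ∃ i, r i = some k)
  have hexp : ∀ S : Finset (Fin n), A (fun _ => w + ∑ i ∈ S, u i)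
      = ∑ r : Fin n → Option (Fin n), if R r ⊆ S then A (U ∘ r) else 0 := by
    intro S
    have h1 : w + ∑ i ∈ S, u i = ∑ k ∈ Finset.insertNone S, U k := by
      rw [Finset.sum_insertNone]; rfl
    rw [h1]
    rw [A.map_sum_finset (fun _ k => U k) (fun _ => Finset.insertNone S), ← Finset.sum_filter]
    refine Finset.sum_congr ?_ (fun _ _ => rfl)
    ext r
    simp only [Fintype.mem_piFinset, Finset.mem_insertNone, Finset.mem_filter, Finset.mem_univ,
      true_and, R, Finset.subset_iff]
    constructor
    · rintro h k ⟨i, hi⟩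
      exact h i k hi
    · intro h i k hk
      exact h ⟨i, hk⟩
  simp_rw [hexp, Finset.mul_sum]
  rw [Finset.sum_comm]
  have h2 : ∀ r : Fin n → Option (Fin n),
      ∑ S : Finset (Fin n), (-1 : ℝ) ^ S.card * (if R r ⊆ S then A (U ∘ r) else 0)
        = if R r = Finset.univ then (-1 : ℝ) ^ n * A (U ∘ r) else 0 := by
    intro r
    have := sum_neg_one_pow_card_of_subset (R r)
    rw [← ite_zero_mul, ← this, Finset.sum_mul]
    refine Finset.sum_congr rfl fun S _ => ?_
    split_ifs <;> simp
  simp_rw [h2]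
  rw [← Finset.sum_filter]
  have h3 : ∑ σ : Equiv.Perm (Fin n), (-1 : ℝ) ^ n * A (u ∘ σ)
      = ∑ r ∈ Finset.univ.filter (fun r => R r = Finset.univ), (-1 : ℝ) ^ n * A (U ∘ r) := by
    refine Finset.sum_bij (fun σ _ => fun i => some (σ i)) ?_ ?_ ?_ ?_
    · intro σ _
      simp only [Finset.mem_filter, Finset.mem_univ, true_and, R, Finset.filter_eq_self]
      intro k _
      exact ⟨σ.symm k, by simp⟩
    · intro σ _ τ _ h
      ext i
      have := congrFun h i
      simpa using congrArg Fin.val (Option.some_injective _ this)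
    · intro r hr
      simp only [Finset.mem_filter, Finset.mem_univ, true_and, R, Finset.filter_eq_self,
        forall_const] at hr
      choose g hg using fun k => hr (x := k)
      have hginj : Function.Injective g := by
        intro a b hab
        have := hg a
        rw [hab, hg b] at this
        exact (Option.some_injective _ this).symm
      let τ : Equiv.Perm (Fin n) := Equiv.ofBijective g (Finite.injective_iff_bijective.1 hginj)
      refine ⟨τ.symm, Finset.mem_univ _, ?_⟩
      funext i
      obtain ⟨k, rfl⟩ := τ.surjective i
      rw [Equiv.symm_apply_apply]
      exact (hg k).symm
    · intro σ _
      rfl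
  rw [← h3]
  simp_rw [hA u]
  simp [Fintype.card_perm]
  ring

theorem opNorm_le_sum_basis {d n : ℕ}
    (A : ContinuousMultilinearMap ℝ (fun _ : Fin n => (Fin d → ℝ)) ℝ) :
    ‖A‖ ≤ ∑ φ : Fin n → Fin d, |A (fun i => Pi.single (φ i) 1)| := by
  classical
  refine A.opNorm_le_bound (Finset.sum_nonneg fun _ _ => abs_nonneg _) fun x => ?_
  have hx : x = fun i => ∑ k, x i k • (Pi.single k 1 : Fin d → ℝ) := by
    funext i
    exact pi_eq_sum_univ' (x i)
  have h1 : A x = ∑ φ : Fin n → Fin d, (∏ i, x i (φ i)) • A (fun i => Pi.single (φ i) 1) := by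
    conv_lhs => rw [hx]
    rw [A.map_sum]
    refine Finset.sum_congr rfl fun φ _ => ?_
    rw [A.map_smul_univ]
  rw [h1, Finset.sum_mul]
  refine (norm_sum_le _ _).trans (Finset.sum_le_sum fun φ _ => ?_)
  rw [norm_smul, mul_comm, Real.norm_eq_abs]
  gcongr
  rw [norm_prod]
  exact Finset.prod_le_prod (fun _ _ => norm_nonneg _) fun i _ => norm_le_pi_norm (x i) (φ i)

theorem iteratedFDeriv_apply_swap_castSucc_succ {E : Type*} [NormedAddCommGroup E]
    [NormedSpace ℝ E] {f : E → ℝ} (hf : ContDiff ℝ (⊤ : ℕ∞) f) :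
    ∀ (n : ℕ) (i : Fin n) (v : Fin (n + 1) → E) (x : E),
      iteratedFDeriv ℝ (n + 1) f x (v ∘ Equiv.swap i.castSucc i.succ)
        = iteratedFDeriv ℝ (n + 1) f x v := by
  have hdiff : ∀ n : ℕ, Differentiable ℝ (iteratedFDeriv ℝ n f) := fun n =>
    hf.differentiable_iteratedFDeriv (mod_cast ENat.natCast_lt_top n)
  intro n
  induction n with
  | zero => exact fun i => i.elim0
  | succ n ih =>
    intro i v x
    rw [(hdiff (n + 1) x).iteratedFDeriv_succ_apply_left',
      (hdiff (n + 1) x).iteratedFDeriv_succ_apply_left']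
    induction i using Fin.cases with
    | zero =>
      have h2 : ∀ (u : Fin (n + 1) → E), (fun y => iteratedFDeriv ℝ (n + 1) f y u)
          = fun y => fderiv ℝ (fun z => iteratedFDeriv ℝ n f z (Fin.tail u)) y (u 0) := by
        intro u
        funext y
        exact (hdiff n y).iteratedFDeriv_succ_apply_left'
      rw [h2, h2]
      set g : E → ℝ := fun z => iteratedFDeriv ℝ n f z (Fin.tail (Fin.tail v)) with hg
      have htail : Fin.tail (Fin.tail (v ∘ Equiv.swap (Fin.castSucc 0) (Fin.succ 0)))
          = Fin.tail (Fin.tail v) := by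
        funext k
        simp only [Fin.tail, Function.comp]
        rw [Equiv.swap_apply_of_ne_of_ne]
        · simp [Fin.ext_iff]
        · simp [Fin.ext_iff]
      rw [htail]
      have hgd : ContDiff ℝ 2 g := by
        have h3 : ContDiff ℝ 2 (iteratedFDeriv ℝ n f) :=
          hf.iteratedFDeriv_right (WithTop.coe_le_coe.2 (le_top : (2 + n : ℕ∞) ≤ ⊤))
        exact (ContinuousMultilinearMap.apply ℝ (fun _ : Fin n => E) ℝ
          (Fin.tail (Fin.tail v))).contDiff.comp h3
      have hsym : IsSymmSndFDerivAt ℝ g x :=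
        hgd.contDiffAt.isSymmSndFDerivAt (by simp)
      have hd : DifferentiableAt ℝ (fderiv ℝ g) x :=
        (hgd.fderiv_right (m := 1) (by norm_num)).differentiable (by norm_num) x
      have h4 : ∀ a b : E, fderiv ℝ (fun y => fderiv ℝ g y a) x b
          = fderiv ℝ (fderiv ℝ g) x b a := by
        intro a b
        rw [fderiv_clm_apply hd (by fun_prop)]
        simp
      rw [h4, h4]
      convert hsym _ _ using 3 <;> simp [Fin.tail]
    | succ i =>
      have h0 : (v ∘ Equiv.swap i.succ.castSucc i.succ.succ) 0 = v 0 := by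
        simp only [Function.comp]
        rw [Equiv.swap_apply_of_ne_of_ne] <;> simp [Fin.ext_iff]
      have h1 : Fin.tail (v ∘ Equiv.swap i.succ.castSucc i.succ.succ)
          = Fin.tail v ∘ Equiv.swap i.castSucc i.succ := by
        funext k
        simp only [Fin.tail, Function.comp, Equiv.swap_apply_def]
        congr 1
        simp only [Fin.ext_iff, apply_ite Fin.val, apply_ite Fin.succ, Fin.val_succ,
          Fin.val_castSucc]
        grind
      rw [h0, h1]
      simp_rw [ih i]

theorem iteratedFDeriv_apply_comp_perm {E : Type*} [NormedAddCommGroup E]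
    [NormedSpace ℝ E] {f : E → ℝ} (hf : ContDiff ℝ (⊤ : ℕ∞) f) (n : ℕ) (x : E)
    (v : Fin n → E) (σ : Equiv.Perm (Fin n)) :
    iteratedFDeriv ℝ n f x (v ∘ σ) = iteratedFDeriv ℝ n f x v := by
  cases n with
  | zero => congr; exact Subsingleton.elim _ _
  | succ n =>
    have hσ : σ ∈ Submonoid.closure (range fun i : Fin n => Equiv.swap i.castSucc i.succ) := by
      rw [Equiv.Perm.mclosure_swap_castSucc_succ]; trivial
    induction hσ using Submonoid.closure_induction generalizing v with
    | mem σ h =>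
      obtain ⟨i, rfl⟩ := h
      exact iteratedFDeriv_apply_swap_castSucc_succ hf n i v x
    | one => rfl
    | mul σ τ _ _ h1 h2 =>
      have : v ∘ ⇑(σ * τ) = (v ∘ σ) ∘ τ := rfl
      rw [this, h2, h1]

theorem iteratedDeriv_comp_add_smul {E : Type*} [NormedAddCommGroup E]
    [NormedSpace ℝ E] {f : E → ℝ} (hf : ContDiff ℝ (⊤ : ℕ∞) f) (n : ℕ) (x v : E) :
    iteratedDeriv n (fun t : ℝ => f (x + t • v))
      = fun t => iteratedFDeriv ℝ n f (x + t • v) (fun _ => v) := by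
  induction n with
  | zero => simp
  | succ n ih =>
    rw [iteratedDeriv_succ, ih]
    funext t
    exact ContDiffAt.deriv_fderiv_add_smul (hf.contDiffAt.of_le (by exact_mod_cast le_top))

theorem taylor_remainder_smooth {f : ℝ → ℝ} (hf : ContDiff ℝ (⊤ : ℕ∞) f) (n : ℕ) (x₀ x : ℝ) :
    f x = ∑ k ∈ Finset.range (n + 1), iteratedDeriv k f x₀ / k.factorial * (x - x₀) ^ k
      + ∫ t in x₀..x, (x - t) ^ n / n.factorial * iteratedDeriv (n + 1) f t := by
  induction n with
  | zero =>
    have := intervalIntegral.integral_deriv_eq_sub (f := f) (a := x₀) (b := x)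
      (fun t _ => hf.differentiable (by simp) t)
      ((hf.continuous_deriv (by simp)).intervalIntegrable _ _)
    simp [this]
  | succ n ih =>
    have hd : ∀ t, HasDerivAt (iteratedDeriv (n + 1) f) (iteratedDeriv (n + 2) f t) t := by
      intro t
      rw [iteratedDeriv_succ (n := n + 1)]
      exact (hf.differentiable_iteratedDeriv (n + 1) (mod_cast ENat.natCast_lt_top _) t).hasDerivAt
    have hu : ∀ t, HasDerivAt (fun t => -((x - t) ^ (n + 1) / (n + 1).factorial))
        ((x - t) ^ n / n.factorial) t := by
      intro t
      have h1 : HasDerivAt (fun t => -((x - t) ^ (n + 1) / ((n + 1).factorial : ℝ))) _ t :=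
        ((((hasDerivAt_id t).const_sub x).pow (n + 1)).div_const _).neg
      convert h1 using 1
      rw [Nat.factorial_succ]
      push_cast
      have : (n.factorial : ℝ) ≠ 0 := by positivity
      simp
      field_simp
    have hc : ∀ k : ℕ, Continuous (iteratedDeriv k f) := fun k =>
      hf.continuous_iteratedDeriv k (mod_cast le_top)
    have hparts := intervalIntegral.integral_mul_deriv_eq_deriv_mul
      (a := x₀) (b := x) (fun t _ => hu t) (fun t _ => hd t)
      (Continuous.intervalIntegrable (by fun_prop) _ _) ((hc _).intervalIntegrable _ _)
    rw [Finset.sum_range_succ]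
    simp only [sub_self, neg_mul, intervalIntegral.integral_neg] at hparts
    simp only [ne_eq, Nat.add_eq_zero_iff, one_ne_zero, and_false, not_false_eq_true, zero_pow,
      zero_div, zero_mul, neg_zero, zero_sub] at hparts
    rw [ih]
    linear_combination hparts

theorem iteratedDeriv_iteratedDeriv (f : ℝ → ℝ) (k i : ℕ) :
    iteratedDeriv k (iteratedDeriv i f) = iteratedDeriv (k + i) f := by
  simp only [iteratedDeriv_eq_iterate]
  rw [Function.iterate_add_apply]

theorem contDiff_iteratedDeriv {f : ℝ → ℝ} (hf : ContDiff ℝ (⊤ : ℕ∞) f) (i : ℕ) :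
    ContDiff ℝ (⊤ : ℕ∞) (iteratedDeriv i f) := by
  rw [iteratedDeriv_eq_iterate]
  exact hf.iterate_deriv i

theorem exists_coeff_bound_of_values (n : ℕ) :
    ∃ C : ℝ, 0 ≤ C ∧ ∀ (c : Fin (n + 1) → ℝ) (N : ℝ),
      (∀ y ∈ Icc (0 : ℝ) 1, |∑ k, c k * y ^ (k : ℕ)| ≤ N) → ∀ k, |c k| ≤ C * N := by
  let y : Fin (n + 1) → ℝ := fun q => (q : ℝ) / (n + 1)
  have hy : Function.Injective y := by
    intro a b hab
    have h1 : (n : ℝ) + 1 ≠ 0 := by positivity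
    have h2 : (a : ℝ) = b := by simpa [y, div_left_inj' h1] using hab
    exact Fin.ext (by exact_mod_cast h2)
  let V := Matrix.vandermonde y
  have hV : IsUnit V.det := isUnit_iff_ne_zero.2 (Matrix.det_vandermonde_ne_zero_iff.2 hy)
  refine ⟨∑ k, ∑ q, |V⁻¹ k q|, by positivity, fun c N hN k => ?_⟩
  have hc : c = V⁻¹.mulVec (V.mulVec c) := by
    rw [Matrix.mulVec_mulVec, Matrix.nonsing_inv_mul _ hV, Matrix.one_mulVec]
  have hval : ∀ q, |V.mulVec c q| ≤ N := by
    intro q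
    have := hN (y q) ⟨by positivity, by
      rw [div_le_one (by positivity)]
      exact_mod_cast q.is_lt.le⟩
    convert this using 2
    simp [V, Matrix.mulVec, dotProduct, Matrix.vandermonde_apply, mul_comm]
  have hN0 : 0 ≤ N := (abs_nonneg _).trans (hval 0)
  calc |c k| = |∑ q, V⁻¹ k q * V.mulVec c q| := by
        conv_lhs => rw [hc]
        rfl
    _ ≤ ∑ q, |V⁻¹ k q| * N := by
        refine (Finset.abs_sum_le_sum_abs _ _).trans (Finset.sum_le_sum fun q _ => ?_)
        rw [abs_mul]
        gcongr
        exact hval q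
    _ = (∑ q, |V⁻¹ k q|) * N := by rw [Finset.sum_mul]
    _ ≤ _ := by
        refine mul_le_mul_of_nonneg_right ?_ hN0
        exact Finset.single_le_sum (f := fun k => ∑ q, |V⁻¹ k q|)
          (fun _ _ => by positivity) (Finset.mem_univ k)

theorem abs_taylor_remainder_le {g : ℝ → ℝ} (hg : Continuous g) (k : ℕ) {a ℓ x : ℝ}
    (hx : x ∈ Icc a (a + ℓ)) :
    |∫ t in a..x, (x - t) ^ k / k.factorial * g t| ≤ ℓ ^ k * ∫ t in a..a + ℓ, |g t| := by
  have hℓ : 0 ≤ ℓ := by linarith [hx.1, hx.2]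
  have hc : Continuous fun t => (x - t) ^ k / k.factorial * g t := by fun_prop
  calc |∫ t in a..x, (x - t) ^ k / k.factorial * g t|
      ≤ ∫ t in a..x, |(x - t) ^ k / k.factorial * g t| :=
        intervalIntegral.abs_integral_le_integral_abs hx.1
    _ ≤ ∫ t in a..x, ℓ ^ k * |g t| := by
        refine intervalIntegral.integral_mono_on hx.1 (hc.abs.intervalIntegrable _ _)
          ((continuous_const.mul hg.abs).intervalIntegrable _ _) fun t ht => ?_
        rw [abs_mul, abs_div, abs_pow]
        gcongr
        have h1 : |x - t| ≤ ℓ := by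
          rw [abs_of_nonneg (by linarith [ht.2])]
          linarith [ht.1, hx.2]
        have h2 : (1 : ℝ) ≤ |(k.factorial : ℝ)| := by
          rw [Nat.abs_cast]; exact_mod_cast k.factorial_pos
        calc |x - t| ^ k / |(k.factorial : ℝ)| ≤ |x - t| ^ k := div_le_self (by positivity) h2
          _ ≤ ℓ ^ k := by gcongr
    _ = ℓ ^ k * ∫ t in a..x, |g t| := intervalIntegral.integral_const_mul _ _
    _ ≤ _ := by
        gcongr
        exact intervalIntegral.integral_mono_interval le_rfl hx.1 hx.2
          (Filter.Eventually.of_forall fun _ => abs_nonneg _) (hg.abs.intervalIntegrable _ _)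

theorem exists_iteratedDeriv_bound (n : ℕ) :
    ∃ C : ℝ, 0 < C ∧ ∀ (h : ℝ → ℝ) (a ℓ N : ℝ), ContDiff ℝ (⊤ : ℕ∞) h → 0 < ℓ → 0 < N →
      (∀ t ∈ Icc a (a + ℓ), |h t| ≤ N) →
      ℓ ^ (2 * n + 1) * (∫ t in a..a + ℓ, iteratedDeriv (n + 1) h t ^ 2) ≤ N ^ 2 →
      ∀ i ≤ n, ∀ t ∈ Icc a (a + ℓ), |iteratedDeriv i h t| * ℓ ^ i ≤ C * N := by
  obtain ⟨C₁, hC₁, hcoef⟩ := exists_coeff_bound_of_values n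
  refine ⟨(n + 1) * (n.factorial * (C₁ * 2)) + 1, by positivity, ?_⟩
  intro h a ℓ N hh hℓ hN hbd hI i hi t ht
  set g := iteratedDeriv (n + 1) h with hg
  have hgc : Continuous g := hh.continuous_iteratedDeriv _ (mod_cast le_top)
  set J := ∫ t in a..a + ℓ, |g t| with hJ
  have hJ0 : 0 ≤ J := intervalIntegral.integral_nonneg (by linarith) fun _ _ => abs_nonneg _
  have hJN : ℓ ^ n * J ≤ N := by
    have h1 : J ≤ ∫ t in a..a + ℓ, (ℓ ^ (n + 1) / (2 * N) * g t ^ 2 + N / (2 * ℓ ^ (n + 1))) := by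
      refine intervalIntegral.integral_mono_on (by linarith) (hgc.abs.intervalIntegrable _ _)
        (Continuous.intervalIntegrable (by fun_prop) _ _) fun t _ => ?_
      have h2 : ℓ ^ (n + 1) / (2 * N) * g t ^ 2 + N / (2 * ℓ ^ (n + 1)) - |g t|
          = (ℓ ^ (n + 1) * |g t| - N) ^ 2 / (2 * N * ℓ ^ (n + 1)) := by
        rw [← sq_abs (g t)]
        field_simp
        ring
      have h3 : 0 ≤ (ℓ ^ (n + 1) * |g t| - N) ^ 2 / (2 * N * ℓ ^ (n + 1)) := by positivity
      linarith
    rw [intervalIntegral.integral_add (Continuous.intervalIntegrable (by fun_prop) _ _)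
      (by simp), intervalIntegral.integral_const_mul] at h1
    simp only [intervalIntegral.integral_const, add_sub_cancel_left, smul_eq_mul] at h1
    calc ℓ ^ n * J ≤ ℓ ^ n * (ℓ ^ (n + 1) / (2 * N) * (∫ t in a..a + ℓ, g t ^ 2)
          + ℓ * (N / (2 * ℓ ^ (n + 1)))) := by gcongr
      _ = (ℓ ^ (2 * n + 1) * ∫ t in a..a + ℓ, g t ^ 2) / (2 * N) + N / 2 := by
          field_simp
          ring
      _ ≤ N ^ 2 / (2 * N) + N / 2 := by gcongr
      _ = N := by field_simp; ring
  have hcoef' : ∀ k ≤ n, |iteratedDeriv k h a| * ℓ ^ k ≤ n.factorial * (C₁ * 2) * N := by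
    have h1 := hcoef (fun k => iteratedDeriv k h a / (k : ℕ).factorial * ℓ ^ (k : ℕ)) (2 * N) ?_
    · intro k hk
      have h2 := h1 ⟨k, by omega⟩
      simp only [abs_mul, abs_div, Nat.abs_cast, abs_pow, abs_of_pos hℓ] at h2
      have h3 : (k.factorial : ℝ) ≤ n.factorial := by exact_mod_cast Nat.factorial_le hk
      have h4 : (0 : ℝ) < k.factorial := by positivity
      calc |iteratedDeriv k h a| * ℓ ^ k
          = k.factorial * (|iteratedDeriv k h a| / k.factorial * ℓ ^ k) := by field_simp
        _ ≤ n.factorial * (C₁ * (2 * N)) := by gcongr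
        _ = _ := by ring
    · intro y hy
      have hx : a + ℓ * y ∈ Icc a (a + ℓ) :=
        ⟨by nlinarith [hy.1], by nlinarith [hy.2]⟩
      have h2 := taylor_remainder_smooth hh n a (a + ℓ * y)
      rw [Finset.sum_range] at h2
      have h3 := abs_taylor_remainder_le hgc n hx
      have h4 := hbd _ hx
      have h5 : ∑ k : Fin (n + 1), iteratedDeriv k h a / (k : ℕ).factorial * ℓ ^ (k : ℕ)
          * y ^ (k : ℕ) = ∑ k : Fin (n + 1), iteratedDeriv k h a / (k : ℕ).factorial
            * (a + ℓ * y - a) ^ (k : ℕ) := by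
        refine Finset.sum_congr rfl fun k _ => ?_
        rw [add_sub_cancel_left, mul_pow, mul_assoc]
      rw [h5]
      rw [abs_le] at *
      constructor <;> linarith [h3.1, h3.2, h4.1, h4.2]
  obtain ⟨r, rfl⟩ := Nat.exists_eq_add_of_le hi
  have h2 := taylor_remainder_smooth (contDiff_iteratedDeriv hh i) r a t
  simp only [iteratedDeriv_iteratedDeriv] at h2
  have h6 : r + 1 + i = i + r + 1 := by ring
  rw [h6, ← hg] at h2
  have h3 := abs_taylor_remainder_le hgc r ht
  have ht' : |t - a| ≤ ℓ := by rw [abs_le]; constructor <;> linarith [ht.1, ht.2]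
  have h7 : |∑ k ∈ Finset.range (r + 1), iteratedDeriv (k + i) h a / k.factorial * (t - a) ^ k|
      * ℓ ^ i ≤ (r + 1) * ((i + r).factorial * (C₁ * 2) * N) := by
    calc _ ≤ (∑ k ∈ Finset.range (r + 1),
          |iteratedDeriv (k + i) h a / k.factorial * (t - a) ^ k|) * ℓ ^ i := by
          gcongr; exact Finset.abs_sum_le_sum_abs _ _
      _ = ∑ k ∈ Finset.range (r + 1),
          |iteratedDeriv (k + i) h a / k.factorial * (t - a) ^ k| * ℓ ^ i := Finset.sum_mul _ _ _
      _ ≤ ∑ k ∈ Finset.range (r + 1), ((i + r).factorial * (C₁ * 2) * N) := by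
          refine Finset.sum_le_sum fun k hk => ?_
          rw [Finset.mem_range] at hk
          refine le_trans ?_ (hcoef' (k + i) (by omega))
          rw [abs_mul, abs_div, Nat.abs_cast, abs_pow, pow_add, ← mul_assoc]
          gcongr
          exact div_le_self (abs_nonneg _) (by exact_mod_cast k.factorial_pos)
      _ = _ := by simp
  have h8 : |∫ u in a..t, (t - u) ^ r / r.factorial * g u| * ℓ ^ i ≤ N := by
    calc _ ≤ ℓ ^ r * J * ℓ ^ i := by gcongr
      _ = ℓ ^ (i + r) * J := by rw [pow_add]; ring
      _ ≤ N := hJN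
  rw [h2]
  have h9 : (0:ℝ) ≤ i := by positivity
  calc _ ≤ (|∑ k ∈ Finset.range (r + 1), iteratedDeriv (k + i) h a / k.factorial * (t - a) ^ k|
        + |∫ u in a..t, (t - u) ^ r / r.factorial * g u|) * ℓ ^ i := by
        gcongr; exact abs_add_le _ _
    _ ≤ (r + 1) * ((i + r).factorial * (C₁ * 2) * N) + N := by rw [add_mul]; gcongr
    _ ≤ (((i + r : ℕ) : ℝ) + 1) * ((i + r).factorial * (C₁ * 2) * N) + N := by
        gcongr; linarith
    _ = _ := by ring

theorem lintegral_Ioi_eq_Ioc_add_Ioi (F : ℝ → ℝ≥0∞) {a b : ℝ} (hab : a ≤ b) :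
    ∫⁻ t in Ioi a, F t = (∫⁻ t in Ioc a b, F t) + ∫⁻ t in Ioi b, F t := by
  rw [← Ioc_union_Ioi_eq_Ioi hab, lintegral_union measurableSet_Ioi]
  exact (Ioi_disjoint_Iic le_rfl).symm.mono_left Ioc_subset_Iic_self

theorem ofReal_intervalIntegral_eq_lintegral {f : ℝ → ℝ} (hf : Continuous f) {a b : ℝ}
    (hab : a ≤ b) (h0 : ∀ t ∈ Ioc a b, 0 ≤ f t) :
    ENNReal.ofReal (∫ t in a..b, f t) = ∫⁻ t in Ioc a b, ENNReal.ofReal (f t) := by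
  rw [intervalIntegral.integral_of_le hab, ofReal_integral_eq_lintegral_ofReal]
  · exact (intervalIntegrable_iff_integrableOn_Ioc_of_le hab).1 (hf.intervalIntegrable _ _)
  · exact (ae_restrict_iff' measurableSet_Ioc).2 (Filter.Eventually.of_forall h0)

theorem rpow_le_two_rpow_abs_mul {a t s : ℝ} (ha : 0 < a) (h1 : a ≤ t) (h2 : t ≤ 2 * a) :
    t ^ s ≤ 2 ^ |s| * a ^ s := by
  have hta : 1 ≤ t / a := by rwa [one_le_div ha]
  have : t ^ s = (t / a) ^ s * a ^ s := by
    rw [← Real.mul_rpow (by positivity) ha.le, div_mul_cancel₀ _ ha.ne']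
  rw [this]
  gcongr
  calc (t / a) ^ s ≤ (t / a) ^ |s| := Real.rpow_le_rpow_of_exponent_le hta (le_abs_self s)
    _ ≤ 2 ^ |s| := by
        apply Real.rpow_le_rpow (by positivity) _ (abs_nonneg s)
        rwa [div_le_iff₀ ha]

theorem exists_local_bound (n j : ℕ) (σ : ℝ) (hj : 0 < j) (hjn : j ≤ n) :
    ∃ K : ℝ, 0 < K ∧ ∀ (h : ℝ → ℝ) (a ℓ : ℝ), ContDiff ℝ (⊤ : ℕ∞) h →
      (∀ t, 0 < t → |h t| ≤ √t) → 0 < ℓ → ℓ ≤ a →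
      ℓ ^ (2 * n + 1) * (∫ t in a..a + ℓ, iteratedDeriv (n + 1) h t ^ 2) ≤ 2 * a →
      ∫⁻ t in Ioc a (a + ℓ), ENNReal.ofReal (t ^ (2 * σ + 1 - (n + 1) / j)
          * |iteratedDeriv j h t| ^ (2 * (n + 1) / j : ℝ))
        ≤ ENNReal.ofReal (K * a ^ (2 * σ + 1) / ℓ ^ (2 * n + 1)) := by
  obtain ⟨C, hC, hbd⟩ := exists_iteratedDeriv_bound n
  set s : ℝ := 2 * σ + 1 - (n + 1) / j with hs
  set p : ℝ := 2 * (n + 1) / j with hp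
  have hj' : (0 : ℝ) < j := by exact_mod_cast hj
  have hp0 : 0 < p := by positivity
  refine ⟨2 ^ |s| * (C ^ p * 2 ^ (p / 2)), by positivity, ?_⟩
  intro h a ℓ hh hle hℓ hℓa hI
  have ha : 0 < a := hℓ.trans_le hℓa
  have h1 := hbd h a ℓ (√(2 * a)) hh hℓ (by positivity) (fun t ht =>
    (hle t (ha.trans_le ht.1)).trans (Real.sqrt_le_sqrt (by linarith [ht.2])))
    (by rwa [Real.sq_sqrt (by positivity)]) j hjn
  have hpt : ∀ t ∈ Ioc a (a + ℓ), t ^ s * |iteratedDeriv j h t| ^ p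
      ≤ 2 ^ |s| * (C ^ p * 2 ^ (p / 2)) * a ^ (2 * σ + 1) / ℓ ^ (2 * n + 2) := by
    intro t ht
    have h2 := h1 t ⟨ht.1.le, ht.2⟩
    have h3 : |iteratedDeriv j h t| ≤ C * √(2 * a) / ℓ ^ j := by
      rwa [le_div_iff₀ (by positivity)]
    have h4 : (ℓ ^ j) ^ p = ℓ ^ (2 * n + 2) := by
      rw [← Real.rpow_natCast, ← Real.rpow_natCast, ← Real.rpow_mul hℓ.le]
      congr 1
      rw [hp]
      push_cast
      field_simp
    have h5 : √(2 * a) ^ p = 2 ^ (p / 2) * a ^ (p / 2) := by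
      rw [Real.sqrt_eq_rpow, ← Real.rpow_mul (by positivity), Real.mul_rpow (by norm_num) ha.le]
      congr 2 <;> ring
    have h6 : a ^ (2 * σ + 1) = a ^ s * a ^ (p / 2) := by
      rw [← Real.rpow_add ha]
      congr 1
      rw [hs, hp]
      ring
    calc t ^ s * |iteratedDeriv j h t| ^ p
        ≤ (2 ^ |s| * a ^ s) * (C * √(2 * a) / ℓ ^ j) ^ p := by
          gcongr
          exact rpow_le_two_rpow_abs_mul ha ht.1.le (by linarith [ht.2])
      _ = _ := by
          rw [Real.div_rpow (by positivity) (by positivity), Real.mul_rpow hC.le (by positivity),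
            h4, h5, h6]
          ring
  calc _ ≤ ∫⁻ t in Ioc a (a + ℓ), ENNReal.ofReal
        (2 ^ |s| * (C ^ p * 2 ^ (p / 2)) * a ^ (2 * σ + 1) / ℓ ^ (2 * n + 2)) :=
        setLIntegral_mono measurable_const fun t ht => ENNReal.ofReal_le_ofReal (hpt t ht)
    _ = _ := by
        rw [setLIntegral_const, Real.volume_Ioc, ← ENNReal.ofReal_mul (by positivity)]
        congr 1
        rw [add_sub_cancel_left, pow_succ _ (2 * n + 1)]
        field_simp

theorem exists_tail_bound (n j : ℕ) (σ : ℝ) (hj : 0 < j) (hjn : j ≤ n) (hσ0 : 0 < σ)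
    (hσ : σ < n) :
    ∃ K : ℝ, 0 < K ∧ ∀ (h : ℝ → ℝ) (R : ℝ), ContDiff ℝ (⊤ : ℕ∞) h →
      (∀ t, 0 < t → |h t| ≤ √t) → (∀ t, R < t → iteratedDeriv j h t = 0) →
      ∫⁻ t in Ioi 1, ENNReal.ofReal (t ^ (2 * σ + 1 - (n + 1) / j)
          * |iteratedDeriv j h t| ^ (2 * (n + 1) / j : ℝ))
        ≤ ENNReal.ofReal K * (∫⁻ t in Ioi 1, ENNReal.ofReal
            (t ^ (2 * σ) * iteratedDeriv (n + 1) h t ^ 2)) + ENNReal.ofReal K := by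
  obtain ⟨K, hK, hloc⟩ := exists_local_bound n j σ hj hjn
  set β : ℝ := 2 * n - 2 * σ with hβ
  have hβ0 : 0 < β := by linarith
  have h2β : (2 : ℝ) ^ (-β) < 1 := Real.rpow_lt_one_of_one_lt_of_neg (by norm_num) (by linarith)
  set K' : ℝ := K / (1 - 2 ^ (-β)) with hK'
  have hsub : 0 < 1 - (2 : ℝ) ^ (-β) := by linarith
  have hK'0 : 0 < K' := div_pos hK hsub
  refine ⟨max K K', lt_max_of_lt_left hK, ?_⟩
  intro h R hh hle hR
  set F : ℝ → ℝ≥0∞ := fun t => ENNReal.ofReal (t ^ (2 * σ + 1 - (n + 1) / j)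
          * |iteratedDeriv j h t| ^ (2 * (n + 1) / j : ℝ)) with hF
  set g := iteratedDeriv (n + 1) h with hg
  have hgc : Continuous g := hh.continuous_iteratedDeriv _ (mod_cast le_top)
  set G : ℝ → ℝ≥0∞ := fun t => ENNReal.ofReal (t ^ (2 * σ) * g t ^ 2) with hG
  have hj' : (0 : ℝ) < j := by exact_mod_cast hj
  obtain ⟨B, hB⟩ := (isCompact_Icc (a := (0 : ℝ)) (b := 2 * R)).exists_bound_of_continuousOn
    hgc.continuousOn
  set δ : ℝ := 1 / (B ^ 2 + 1) with hδ
  have hδ0 : 0 < δ := by positivity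
  have hδ1 : δ ≤ 1 := by
    rw [hδ, div_le_one (by positivity)]
    nlinarith [sq_nonneg B]
  have key : ∀ k : ℕ, ∀ a : ℝ, 1 ≤ a → R ≤ a + k * δ →
      ∫⁻ t in Ioi a, F t ≤ ENNReal.ofReal K * (∫⁻ t in Ioi a, G t)
        + ENNReal.ofReal (K' * a ^ (-β)) := by
    intro k
    have hzero : ∀ a : ℝ, R ≤ a → ∫⁻ t in Ioi a, F t = 0 := by
      intro a ha
      rw [setLIntegral_eq_zero measurableSet_Ioi]
      intro t ht
      have : (2 * ((n : ℝ) + 1) / j) ≠ 0 := by positivity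
      simp [hF, hR t (ha.trans_lt ht), Real.zero_rpow this]
    induction k with
    | zero =>
      intro a _ ha2
      rw [hzero a (by simpa using ha2)]
      exact zero_le
    | succ k ih =>
      intro a ha1 ha2
      have ha0 : 0 < a := by linarith
      by_cases hRa : R ≤ a
      · rw [hzero a hRa]
        exact zero_le
      push Not at hRa
      set ψ : ℝ → ℝ := fun ℓ => ℓ ^ (2 * n + 1) * (∫ t in a..a + ℓ, g t ^ 2) with hψ
      have hψc : Continuous ψ := by
        have h1 : Continuous fun x => ∫ t in a..x, g t ^ 2 :=
          intervalIntegral.continuous_primitive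
            (fun _ _ => (hgc.pow 2).intervalIntegrable _ _) a
        exact (continuous_pow _).mul (h1.comp (continuous_const.add continuous_id))
      rcases le_or_gt (ψ a) (2 * a) with hcase | hcase
      · have h1 := hloc h a a hh hle ha0 le_rfl hcase
        have h2 := ih (a + a) (by linarith) (by push_cast at ha2; nlinarith)
        have haβ : a ^ (2 * σ + 1) / a ^ (2 * n + 1) = a ^ (-β) := by
          rw [← Real.rpow_natCast, ← Real.rpow_sub ha0]
          congr 1
          push_cast
          ring
        rw [mul_div_assoc K, haβ] at h1
        rw [lintegral_Ioi_eq_Ioc_add_Ioi F (show a ≤ a + a by linarith)]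
        calc _ ≤ ENNReal.ofReal (K * a ^ (-β)) + (ENNReal.ofReal K * (∫⁻ t in Ioi (a + a), G t)
              + ENNReal.ofReal (K' * (a + a) ^ (-β))) := add_le_add h1 h2
          _ = ENNReal.ofReal K * (∫⁻ t in Ioi (a + a), G t) + (ENNReal.ofReal (K * a ^ (-β))
              + ENNReal.ofReal (K' * (a + a) ^ (-β))) := by ring
          _ ≤ ENNReal.ofReal K * (∫⁻ t in Ioi a, G t) + ENNReal.ofReal (K' * a ^ (-β)) := by
            gcongr
            · linarith
            · rw [← ENNReal.ofReal_add (by positivity) (by positivity)]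
              apply le_of_eq
              congr 1
              rw [← two_mul, Real.mul_rpow (by norm_num) ha0.le]
              have : K' * (1 - 2 ^ (-β)) = K := div_mul_cancel₀ _ hsub.ne'
              linear_combination (-a ^ (-β)) * this
      · obtain ⟨ℓ, hℓ, hψℓ⟩ : ∃ ℓ ∈ Icc 0 a, ψ ℓ = 2 * a := by
          have := intermediate_value_Icc ha0.le hψc.continuousOn
          exact this ⟨by simp [hψ]; positivity, hcase.le⟩
        have hℓ0 : 0 < ℓ := by
          rcases hℓ.1.eq_or_lt with h0 | h0
          · rw [← h0] at hψℓ
            simp [hψ] at hψℓ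
            linarith
          · exact h0
        have hℓδ : δ ≤ ℓ := by
          by_contra! hlt
          have h1 : ∫ t in a..a + ℓ, g t ^ 2 ≤ ∫ t in a..a + ℓ, B ^ 2 := by
            refine intervalIntegral.integral_mono_on (by linarith)
              ((hgc.pow 2).intervalIntegrable _ _) (by simp) fun t ht => ?_
            have := hB t ⟨by linarith [ht.1], by linarith [ht.2, hℓ.2]⟩
            rw [Real.norm_eq_abs] at this
            rw [← sq_abs]
            gcongr
          simp only [intervalIntegral.integral_const, add_sub_cancel_left, smul_eq_mul] at h1
          have h2 : ℓ ^ (2 * n + 1) ≤ 1 := pow_le_one₀ hℓ0.le (by linarith)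
          have h3 : ψ ℓ ≤ 1 * (δ * B ^ 2) := by
            refine mul_le_mul h2 (h1.trans (by gcongr)) ?_ zero_le_one
            exact intervalIntegral.integral_nonneg (by linarith) fun _ _ => sq_nonneg _
          have h4 : δ * B ^ 2 ≤ 1 := by
            rw [hδ, one_div_mul_eq_div, div_le_one (by positivity)]
            linarith
          linarith
        have h1 := hloc h a ℓ hh hle hℓ0 hℓ.2 hψℓ.le
        have h2 := ih (a + ℓ) (by linarith) (by push_cast at ha2; nlinarith)
        have h3 : ENNReal.ofReal (K * a ^ (2 * σ + 1) / ℓ ^ (2 * n + 1))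
            ≤ ENNReal.ofReal K * ∫⁻ t in Ioc a (a + ℓ), G t := by
          have h4 : ∫⁻ t in Ioc a (a + ℓ), ENNReal.ofReal (a ^ (2 * σ) * g t ^ 2)
              ≤ ∫⁻ t in Ioc a (a + ℓ), G t := by
            refine setLIntegral_mono' measurableSet_Ioc fun t ht => ?_
            have := ht.1.le
            apply ENNReal.ofReal_le_ofReal
            gcongr
          refine le_trans ?_ (mul_le_mul_right h4 _)
          rw [← ofReal_intervalIntegral_eq_lintegral (by fun_prop) (by linarith)
            (fun _ _ => by positivity), ← ENNReal.ofReal_mul hK.le]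
          apply ENNReal.ofReal_le_ofReal
          rw [intervalIntegral.integral_const_mul, mul_div_assoc]
          gcongr
          rw [div_le_iff₀ (by positivity), Real.rpow_add ha0, Real.rpow_one]
          have : a ^ (2 * σ) * (∫ t in a..a + ℓ, g t ^ 2) * ℓ ^ (2 * n + 1)
            = a ^ (2 * σ) * ψ ℓ := by simp only [hψ]; ring
          rw [this, hψℓ]
          gcongr
          linarith
        rw [lintegral_Ioi_eq_Ioc_add_Ioi F (show a ≤ a + ℓ by linarith),
          lintegral_Ioi_eq_Ioc_add_Ioi G (show a ≤ a + ℓ by linarith)]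
        calc _ ≤ ENNReal.ofReal K * (∫⁻ t in Ioc a (a + ℓ), G t)
              + (ENNReal.ofReal K * (∫⁻ t in Ioi (a + ℓ), G t)
              + ENNReal.ofReal (K' * (a + ℓ) ^ (-β))) := add_le_add (h1.trans h3) h2
          _ = ENNReal.ofReal K * ((∫⁻ t in Ioc a (a + ℓ), G t) + ∫⁻ t in Ioi (a + ℓ), G t)
              + ENNReal.ofReal (K' * (a + ℓ) ^ (-β)) := by ring
          _ ≤ _ := by
            have h5 : (a + ℓ) ^ (-β) ≤ a ^ (-β) :=
              Real.rpow_le_rpow_of_nonpos ha0 (by linarith) (by linarith)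
            gcongr
  obtain ⟨k, hk⟩ := exists_nat_ge (R / δ)
  have := key k 1 le_rfl (by rw [div_le_iff₀ hδ0] at hk; linarith)
  simp only [Real.one_rpow, mul_one] at this
  refine this.trans ?_
  gcongr
  · exact le_max_left _ _
  · exact le_max_right _ _

theorem intervalIntegral_rpow_mul_sq_le_one {n : ℕ} {σ : ℝ} (hσ0 : 0 < σ) {h : ℝ → ℝ}
    (hh : ContDiff ℝ (⊤ : ℕ∞) h)
    (hB : ∫⁻ t in Ioi 0, ENNReal.ofReal (t ^ (2 * σ) * iteratedDeriv n h t ^ 2) ≤ 1)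
    {a b : ℝ} (ha : 0 ≤ a) (hab : a ≤ b) :
    ∫ t in a..b, t ^ (2 * σ) * iteratedDeriv n h t ^ 2 ≤ 1 := by
  have hgc : Continuous (iteratedDeriv n h) := hh.continuous_iteratedDeriv _ (mod_cast le_top)
  have hc : Continuous fun t : ℝ => t ^ (2 * σ) * iteratedDeriv n h t ^ 2 :=
    (Real.continuous_rpow_const (by positivity)).mul (hgc.pow 2)
  have h1 : ∀ t ∈ Ioc a b, 0 ≤ t ^ (2 * σ) * iteratedDeriv n h t ^ 2 := fun t ht =>
    mul_nonneg (Real.rpow_nonneg (ha.trans ht.1.le) _) (sq_nonneg _)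
  rw [← ENNReal.ofReal_le_ofReal_iff zero_le_one, ENNReal.ofReal_one,
    ofReal_intervalIntegral_eq_lintegral hc hab h1]
  refine le_trans (lintegral_mono_set fun t ht => ?_) hB
  exact ha.trans_lt ht.1

theorem intervalIntegral_pow_mul_abs_le {r : ℕ} {σ κ : ℝ} (hκ : 0 ≤ κ)
    (hκr : -1 < 2 * r - 2 * σ + κ) {g : ℝ → ℝ} (hg : Continuous g) (hσ0 : 0 < σ)
    {t : ℝ} (ht : 0 < t) (ht1 : t ≤ 1) (hB : ∫ u in t..1, u ^ (2 * σ) * g u ^ 2 ≤ 1) :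
    ∫ u in t..1, u ^ r * |g u| ≤ t ^ (-κ / 2) * (1 / (2 * r - 2 * σ + κ + 1) + 1) := by
  set e := 2 * r - 2 * σ + κ with he
  have hc : Continuous fun u : ℝ => u ^ (2 * σ) * g u ^ 2 :=
    (Real.continuous_rpow_const (by positivity)).mul (hg.pow 2)
  have hi : IntervalIntegrable (fun u : ℝ => u ^ e) volume t 1 :=
    intervalIntegral.intervalIntegrable_rpow' hκr
  have hpt : ∀ u ∈ Icc t 1, u ^ r * |g u|
      ≤ t ^ (-κ / 2) * (u ^ e + u ^ (2 * σ) * g u ^ 2) := by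
    intro u hu
    have hu0 : 0 < u := ht.trans_le hu.1
    have h1 : u ^ r = u ^ (-κ / 2) * (u ^ (e / 2) * u ^ σ) := by
      rw [← Real.rpow_add hu0, ← Real.rpow_add hu0, ← Real.rpow_natCast]
      congr 1
      rw [he]; ring
    have h2 : u ^ (-κ / 2) ≤ t ^ (-κ / 2) :=
      Real.rpow_le_rpow_of_nonpos ht hu.1 (by linarith)
    have h3 : u ^ e = (u ^ (e / 2)) ^ 2 := by
      rw [← Real.rpow_natCast, ← Real.rpow_mul hu0.le]; congr 1; push_cast; ring
    have h4 : u ^ (2 * σ) = (u ^ σ) ^ 2 := by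
      rw [← Real.rpow_natCast, ← Real.rpow_mul hu0.le]; congr 1; push_cast; ring
    rw [h1, h3, h4, mul_assoc]
    have h5 : 0 ≤ (u ^ (-κ / 2)) := by positivity
    refine mul_le_mul h2 ?_ (by positivity) (by positivity)
    rw [← sq_abs (g u)]
    nlinarith [sq_nonneg (u ^ (e / 2) - u ^ σ * |g u|), sq_nonneg (u ^ (e / 2)),
      sq_nonneg (u ^ σ * |g u|)]
  have h0 : ∫ u in t..1, u ^ e ≤ 1 / (e + 1) := by
    rw [integral_rpow (Or.inl hκr), Real.one_rpow]
    have : 0 ≤ t ^ (e + 1) := by positivity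
    gcongr
    · linarith
    · linarith
  calc ∫ u in t..1, u ^ r * |g u|
      ≤ ∫ u in t..1, t ^ (-κ / 2) * (u ^ e + u ^ (2 * σ) * g u ^ 2) := by
        refine intervalIntegral.integral_mono_on ht1 ?_ ?_ hpt
        · exact Continuous.intervalIntegrable (by fun_prop) _ _
        · exact (hi.add (hc.intervalIntegrable _ _)).const_mul _
    _ = t ^ (-κ / 2) * ((∫ u in t..1, u ^ e) + ∫ u in t..1, u ^ (2 * σ) * g u ^ 2) := by
        rw [intervalIntegral.integral_const_mul, intervalIntegral.integral_add hi
          (hc.intervalIntegrable _ _)]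
    _ ≤ _ := by gcongr

theorem exists_pointwise_head_bound (n j : ℕ) (σ κ : ℝ) (hjn : j ≤ n) (hσ0 : 0 < σ)
    (hκ : 0 ≤ κ) (hκr : -1 < 2 * ((n - j : ℕ) : ℝ) - 2 * σ + κ) :
    ∃ K : ℝ, 0 < K ∧ ∀ h : ℝ → ℝ, ContDiff ℝ (⊤ : ℕ∞) h →
      (∀ t, 0 < t → |h t| ≤ √t) →
      ∫⁻ t in Ioi 0, ENNReal.ofReal (t ^ (2 * σ) * iteratedDeriv (n + 1) h t ^ 2) ≤ 1 →
      ∀ t ∈ Ioc (0 : ℝ) 1, |iteratedDeriv j h t| ≤ K * t ^ (-κ / 2) := by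
  obtain ⟨C, hC, hder⟩ := exists_iteratedDeriv_bound n
  set r := n - j with hr
  have hrj : j + r = n := by omega
  set D : ℝ := 1 / (2 * r - 2 * σ + κ + 1) with hD
  have hD0 : 0 < D := one_div_pos.2 (by linarith)
  refine ⟨(r + 1) * (C * √2) + (D + 1), by positivity, ?_⟩
  intro h hh hle hB t ht
  have hgc : Continuous (iteratedDeriv (n + 1) h) :=
    hh.continuous_iteratedDeriv _ (mod_cast le_top)
  have hc : Continuous fun t : ℝ => t ^ (2 * σ) * iteratedDeriv (n + 1) h t ^ 2 :=
    (Real.continuous_rpow_const (by positivity)).mul (hgc.pow 2)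
  have h12 : ∫ u in (1 : ℝ)..(1 + 1), iteratedDeriv (n + 1) h u ^ 2 ≤ 1 := by
    refine le_trans ?_ (intervalIntegral_rpow_mul_sq_le_one hσ0 hh hB zero_le_one
      (show (1 : ℝ) ≤ 1 + 1 by norm_num))
    refine intervalIntegral.integral_mono_on (by norm_num)
      ((hgc.pow 2).intervalIntegrable _ _) (hc.intervalIntegrable _ _) fun u hu => ?_
    exact le_mul_of_one_le_left (sq_nonneg _) (Real.one_le_rpow hu.1 (by positivity))
  have hone : ∀ i ≤ n, |iteratedDeriv i h 1| ≤ C * √2 := by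
    intro i hi
    have := hder h 1 1 (√2) hh one_pos (by positivity) (fun u hu => ?_) (by
      rw [one_pow, one_mul, Real.sq_sqrt (by norm_num)]; linarith) i hi 1 (by simp)
    · simpa using this
    · exact (hle u (by linarith [hu.1])).trans (Real.sqrt_le_sqrt (by linarith [hu.2]))
  have hI := intervalIntegral_pow_mul_abs_le hκ hκr hgc hσ0 ht.1 ht.2
    (intervalIntegral_rpow_mul_sq_le_one hσ0 hh hB ht.1.le ht.2)
  have htay := taylor_remainder_smooth (contDiff_iteratedDeriv hh j) r 1 t
  simp only [iteratedDeriv_iteratedDeriv] at htay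
  rw [show r + 1 + j = n + 1 by omega] at htay
  have hrem : |∫ u in (1 : ℝ)..t, (t - u) ^ r / r.factorial * iteratedDeriv (n + 1) h u|
      ≤ ∫ u in t..1, u ^ r * |iteratedDeriv (n + 1) h u| := by
    rw [intervalIntegral.integral_symm, abs_neg]
    refine (intervalIntegral.abs_integral_le_integral_abs ht.2).trans ?_
    refine intervalIntegral.integral_mono_on ht.2
      (Continuous.intervalIntegrable (by fun_prop) _ _)
      (Continuous.intervalIntegrable (by fun_prop) _ _) fun u hu => ?_
    have hu0 : 0 < u := ht.1.trans_le hu.1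
    rw [abs_mul, abs_div, abs_pow, Nat.abs_cast]
    gcongr
    refine (div_le_self (by positivity) (mod_cast r.factorial_pos)).trans ?_
    gcongr
    rw [abs_le]; constructor <;> linarith [hu.1, ht.1]
  have hsum : |∑ k ∈ Finset.range (r + 1),
      iteratedDeriv (k + j) h 1 / k.factorial * (t - 1) ^ k| ≤ (r + 1) * (C * √2) := by
    refine (Finset.abs_sum_le_sum_abs _ _).trans ?_
    refine (Finset.sum_le_card_nsmul _ _ (C * √2) fun k hk => ?_).trans (by simp)
    rw [abs_mul, abs_div, abs_pow, Nat.abs_cast]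
    have h1 : |t - 1| ^ k ≤ 1 := pow_le_one₀ (abs_nonneg _) (by
      rw [abs_le]; constructor <;> linarith [ht.1, ht.2])
    have h2 : |iteratedDeriv (k + j) h 1| / k.factorial ≤ C * √2 :=
      (div_le_self (abs_nonneg _) (mod_cast k.factorial_pos)).trans
        (hone _ (by have := Finset.mem_range.1 hk; omega))
    calc _ ≤ C * √2 * 1 := by gcongr
      _ = _ := mul_one _
  have hpow : 1 ≤ t ^ (-κ / 2) :=
    Real.one_le_rpow_of_pos_of_le_one_of_nonpos ht.1 ht.2 (by linarith)
  rw [htay]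
  refine (abs_add_le _ _).trans ?_
  calc _ ≤ (r + 1) * (C * √2) + t ^ (-κ / 2) * (D + 1) := add_le_add hsum (hrem.trans hI)
    _ ≤ (r + 1) * (C * √2) * t ^ (-κ / 2) + t ^ (-κ / 2) * (D + 1) := by
      have := le_mul_of_one_le_right (show 0 ≤ (r + 1) * (C * √2) by positivity) hpow
      linarith
    _ = _ := by ring

theorem exists_head_bound (n j : ℕ) (σ : ℝ) (hj : 0 < j) (hjn : j ≤ n) (hσ0 : 0 < σ)
    (hσ1 : ((n : ℝ) - 1) / 2 < σ) (hσ : σ < n) :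
    ∃ K : ℝ, 0 < K ∧ ∀ h : ℝ → ℝ, ContDiff ℝ (⊤ : ℕ∞) h →
      (∀ t, 0 < t → |h t| ≤ √t) →
      ∫⁻ t in Ioi 0, ENNReal.ofReal (t ^ (2 * σ) * iteratedDeriv (n + 1) h t ^ 2) ≤ 1 →
      ∫⁻ t in Ioc 0 1, ENNReal.ofReal (t ^ (2 * σ + 1 - (n + 1) / j)
          * |iteratedDeriv j h t| ^ (2 * (n + 1) / j : ℝ)) ≤ ENNReal.ofReal K := by
  have hj' : (0 : ℝ) < j := by exact_mod_cast hj
  have hjn' : (j : ℝ) ≤ n := by exact_mod_cast hjn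
  have hj1 : (1 : ℝ) ≤ j := by exact_mod_cast hj
  have hr : ((n - j : ℕ) : ℝ) = n - j := by push_cast [hjn]; ring
  obtain ⟨κ, hκ1, hκ2⟩ : ∃ κ, max 0 (2 * σ - 2 * ((n - j : ℕ) : ℝ) - 1) < κ ∧
      κ < (2 * σ + 2) * (j / (n + 1)) - 1 := by
    apply exists_between
    rw [hr, max_lt_iff]
    have hq : (j : ℝ) / (n + 1) * (n + 1) = j := div_mul_cancel₀ _ (by positivity)
    set q : ℝ := (j : ℝ) / (n + 1)
    have hq0 : 0 < q := by positivity
    have hq1 : q < 1 := by rw [div_lt_one (by positivity)]; linarith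
    constructor
    · nlinarith
    · nlinarith
  have hκ0 := (le_max_left _ _).trans_lt hκ1
  have hκr := (le_max_right _ _).trans_lt hκ1
  obtain ⟨K, hK, hpt⟩ := exists_pointwise_head_bound n j σ κ hjn hσ0 hκ0.le (by linarith)
  set p : ℝ := 2 * (n + 1) / j with hp
  have hp0 : 0 < p := by positivity
  set s : ℝ := 2 * σ + 1 - (n + 1) / j with hs
  have he : -1 < s - κ / 2 * p := by
    have h1 : κ / 2 * p = κ * (n + 1) / j := by rw [hp]; ring
    have h2 : κ * (n + 1) / j < ((2 * σ + 2) * (j / (n + 1)) - 1) * (n + 1) / j := by gcongr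
    have h3 : ((2 * σ + 2) * (j / (n + 1)) - 1) * (n + 1) / j = 2 * σ + 2 - (n + 1) / j := by
      field_simp
    linarith
  have hI : IntegrableOn (fun t : ℝ => K ^ p * t ^ (s - κ / 2 * p)) (Ioc 0 1) volume :=
    ((intervalIntegrable_iff_integrableOn_Ioc_of_le zero_le_one).1
      (intervalIntegral.intervalIntegrable_rpow' he)).const_mul _
  refine ⟨(∫ t in Ioc (0 : ℝ) 1, K ^ p * t ^ (s - κ / 2 * p)) + 1, ?_, ?_⟩
  · have : 0 ≤ ∫ t in Ioc (0 : ℝ) 1, K ^ p * t ^ (s - κ / 2 * p) :=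
      setIntegral_nonneg measurableSet_Ioc fun t ht =>
        mul_nonneg (by positivity) (Real.rpow_nonneg ht.1.le _)
    linarith
  intro h hh hle hB
  refine le_trans ?_ (ENNReal.ofReal_le_ofReal (le_add_of_nonneg_right zero_le_one))
  rw [ofReal_integral_eq_lintegral_ofReal hI]
  · refine setLIntegral_mono' measurableSet_Ioc fun t ht => ENNReal.ofReal_le_ofReal ?_
    have h1 := hpt h hh hle hB t ht
    have ht0 := ht.1
    calc _ ≤ t ^ s * (K * t ^ (-κ / 2)) ^ p := by gcongr
      _ = K ^ p * (t ^ s * t ^ (-κ / 2 * p)) := by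
        rw [Real.mul_rpow hK.le (by positivity), ← Real.rpow_mul ht0.le]; ring
      _ = _ := by
        rw [← Real.rpow_add ht0]; congr 2; ring
  · exact (ae_restrict_iff' measurableSet_Ioc).2 (Filter.Eventually.of_forall fun t ht =>
      mul_nonneg (by positivity) (Real.rpow_nonneg ht.1.le _))

theorem exists_normalized_bound (n j : ℕ) (σ : ℝ) (hj : 0 < j) (hjn : j ≤ n) (hσ0 : 0 < σ)
    (hσ1 : ((n : ℝ) - 1) / 2 < σ) (hσ : σ < n) :
    ∃ K : ℝ, 0 < K ∧ ∀ (h : ℝ → ℝ) (R : ℝ), ContDiff ℝ (⊤ : ℕ∞) h →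
      (∀ t, 0 < t → |h t| ≤ √t) → (∀ t, R < t → iteratedDeriv j h t = 0) →
      ∫⁻ t in Ioi 0, ENNReal.ofReal (t ^ (2 * σ) * iteratedDeriv (n + 1) h t ^ 2) ≤ 1 →
      ∫⁻ t in Ioi 0, ENNReal.ofReal (t ^ (2 * σ + 1 - (n + 1) / j)
          * |iteratedDeriv j h t| ^ (2 * (n + 1) / j : ℝ)) ≤ ENNReal.ofReal K := by
  obtain ⟨K₁, hK₁, h₁⟩ := exists_head_bound n j σ hj hjn hσ0 hσ1 hσ
  obtain ⟨K₂, hK₂, h₂⟩ := exists_tail_bound n j σ hj hjn hσ0 hσ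
  refine ⟨K₁ + (K₂ + K₂), by positivity, ?_⟩
  intro h R hh hle hR hB
  rw [lintegral_Ioi_eq_Ioc_add_Ioi _ (zero_le_one' ℝ), ENNReal.ofReal_add hK₁.le (by positivity),
    ENNReal.ofReal_add hK₂.le hK₂.le]
  refine add_le_add (h₁ h hh hle hB) ((h₂ h R hh hle hR).trans ?_)
  gcongr
  refine mul_le_of_le_one_right' (le_trans (lintegral_mono_set ?_) hB)
  exact Ioi_subset_Ioi zero_le_one

theorem lintegral_Ioi_eq_mul_lintegral_comp_mul_left {T : ℝ} (hT : 0 < T) (F : ℝ → ℝ≥0∞) :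
    ∫⁻ t in Ioi 0, F t = ENNReal.ofReal T * ∫⁻ t in Ioi 0, F (T * t) := by
  conv_lhs => rw [← Real.smul_map_volume_mul_left hT.ne', abs_of_pos hT]
  rw [Measure.restrict_smul, lintegral_smul_measure, smul_eq_mul]
  congr 1
  have he : MeasurableEmbedding (T * · : ℝ → ℝ) :=
    (Homeomorph.mulLeft₀ T hT.ne').measurableEmbedding
  rw [he.restrict_map, he.lintegral_map]
  congr 2
  ext t
  simp [hT]

theorem iteratedDeriv_rescale {h : ℝ → ℝ} (hh : ContDiff ℝ (⊤ : ℕ∞) h) (k : ℕ) (c T t : ℝ) :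
    iteratedDeriv k (fun t => c * h (T * t)) t = c * (T ^ k * iteratedDeriv k h (T * t)) := by
  rw [iteratedDeriv_const_mul_field,
    iteratedDeriv_comp_const_mul (hh.of_le (mod_cast le_top)) T]

theorem exists_scaled_bound (n j : ℕ) (σ : ℝ) (hj : 0 < j) (hjn : j ≤ n) (hσ0 : 0 < σ)
    (hσ1 : ((n : ℝ) - 1) / 2 < σ) (hσ : σ < n) :
    ∃ K : ℝ, 0 < K ∧ ∀ (h : ℝ → ℝ) (R M E : ℝ), ContDiff ℝ (⊤ : ℕ∞) h → 0 < M → 0 < E →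
      (∀ t, 0 < t → |h t| ≤ M * √t) → (∀ t, R < t → iteratedDeriv j h t = 0) →
      ∫⁻ t in Ioi 0, ENNReal.ofReal (t ^ (2 * σ) * iteratedDeriv (n + 1) h t ^ 2)
        ≤ ENNReal.ofReal E →
      ∫⁻ t in Ioi 0, ENNReal.ofReal (t ^ (2 * σ + 1 - (n + 1) / j)
          * |iteratedDeriv j h t| ^ (2 * (n + 1) / j : ℝ))
        ≤ ENNReal.ofReal (K * M ^ (2 * (n + 1) / j - 2 : ℝ) * E) := by
  obtain ⟨K, hK, hmain⟩ := exists_normalized_bound n j σ hj hjn hσ0 hσ1 hσ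
  refine ⟨K, hK, ?_⟩
  intro h R M E hh hM hE hle hR hB
  have hj' : (0 : ℝ) < j := by exact_mod_cast hj
  set p : ℝ := 2 * (n + 1) / j with hp
  set s : ℝ := 2 * σ + 1 - (n + 1) / j with hs
  set β : ℝ := 2 * n - 2 * σ with hβ
  have hβ0 : 0 < β := by linarith
  set T : ℝ := (M ^ 2 / E) ^ (1 / β) with hT
  have hT0 : 0 < T := by positivity
  have hTβ : T ^ β = M ^ 2 / E := by
    rw [hT, ← Real.rpow_mul (by positivity), one_div_mul_cancel hβ0.ne', Real.rpow_one]
  set c : ℝ := (M * √T)⁻¹ with hc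
  have hc0 : 0 < c := by positivity
  set g : ℝ → ℝ := fun t => c * h (T * t) with hg
  have hgk : ∀ k t, iteratedDeriv k g t = c * (T ^ k * iteratedDeriv k h (T * t)) := fun k t =>
    iteratedDeriv_rescale hh k c T t
  have hgs : ContDiff ℝ (⊤ : ℕ∞) g := by
    have : ContDiff ℝ (⊤ : ℕ∞) fun t => h (T * t) := hh.comp (contDiff_const.mul contDiff_id)
    exact contDiff_const.mul this
  have hgle : ∀ t, 0 < t → |g t| ≤ √t := by
    intro t ht
    have h1 := hle (T * t) (by positivity)
    rw [hg]
    simp only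
    rw [abs_mul, abs_of_pos hc0, hc, inv_mul_le_iff₀ (by positivity), mul_assoc,
      ← Real.sqrt_mul hT0.le]
    exact h1
  have hgR : ∀ t, R / T < t → iteratedDeriv j g t = 0 := by
    intro t ht
    rw [div_lt_iff₀ hT0] at ht
    rw [hgk, hR _ (by linarith)]
    simp
  have hsq : √T ^ 2 = T := Real.sq_sqrt hT0.le
  have hgB : ∫⁻ t in Ioi 0, ENNReal.ofReal (t ^ (2 * σ) * iteratedDeriv (n + 1) g t ^ 2) ≤ 1 := by
    have hcoef : T ^ (2 * σ) * (T * E⁻¹) = (c * T ^ (n + 1)) ^ 2 := by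
      have h1 : T ^ (2 * n : ℝ) = T ^ (2 * σ) * (M ^ 2 / E) := by
        rw [← hTβ, ← Real.rpow_add hT0]; congr 1; rw [hβ]; ring
      have h2 : T ^ (2 * n : ℝ) = T ^ (2 * n) := by
        rw [← Real.rpow_natCast]; push_cast; rfl
      have h3 : (c * T ^ (n + 1)) ^ 2 = T ^ (2 * n) * T / M ^ 2 := by
        rw [mul_pow, hc, inv_pow, mul_pow, hsq, ← pow_mul]
        field_simp
        ring
      rw [h3, ← h2, h1]
      field_simp
    have h4 : ∀ t ∈ Ioi (0 : ℝ), ENNReal.ofReal (t ^ (2 * σ) * iteratedDeriv (n + 1) g t ^ 2)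
        = ENNReal.ofReal (T * E⁻¹) * ENNReal.ofReal
          ((T * t) ^ (2 * σ) * iteratedDeriv (n + 1) h (T * t) ^ 2) := by
      intro t ht
      rw [← ENNReal.ofReal_mul (by positivity), hgk]
      congr 1
      rw [Real.mul_rpow hT0.le (le_of_lt ht), ← mul_assoc, mul_pow, ← hcoef]
      ring
    rw [setLIntegral_congr_fun measurableSet_Ioi h4,
      lintegral_const_mul' _ _ ENNReal.ofReal_ne_top, mul_comm T,
      ENNReal.ofReal_mul (by positivity), mul_assoc, ← lintegral_Ioi_eq_mul_lintegral_comp_mul_left hT0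
        (fun t => ENNReal.ofReal (t ^ (2 * σ) * iteratedDeriv (n + 1) h t ^ 2))]
    calc _ ≤ ENNReal.ofReal E⁻¹ * ENNReal.ofReal E := by gcongr
      _ = 1 := by
        rw [← ENNReal.ofReal_mul (by positivity), inv_mul_cancel₀ hE.ne', ENNReal.ofReal_one]
  have hA := hmain g (R / T) hgs hgle hgR hgB
  set D : ℝ := M ^ (p - 2) * E / T with hD
  have hD0 : 0 < D := by positivity
  have hcoef : D * (c * T ^ j) ^ p = T ^ s := by
    have h1 : c = M⁻¹ * T ^ (-1 / 2 : ℝ) := by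
      rw [hc, mul_inv, Real.sqrt_eq_rpow, ← Real.rpow_neg hT0.le]
      norm_num
    have h2 : (c * T ^ j) = M⁻¹ * T ^ ((j : ℝ) - 1 / 2) := by
      rw [h1, mul_assoc, ← Real.rpow_natCast, ← Real.rpow_add hT0]
      congr 2; ring
    have h3 : (c * T ^ j) ^ p = (M ^ p)⁻¹ * T ^ (((j : ℝ) - 1 / 2) * p) := by
      rw [h2, Real.mul_rpow (by positivity) (by positivity), ← Real.rpow_mul hT0.le,
        Real.inv_rpow hM.le]
    have h4 : M ^ (p - 2) * E = M ^ p * T ^ (-β) := by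
      rw [Real.rpow_neg hT0.le, hTβ, Real.rpow_sub hM, Real.rpow_two]
      field_simp
    have h5 : T ^ (-β) * T ^ (((j : ℝ) - 1 / 2) * p) = T ^ s * T := by
      rw [← Real.rpow_add hT0]
      nth_rewrite 3 [← Real.rpow_one T]
      rw [← Real.rpow_add hT0]
      congr 1
      rw [hβ, hs, hp]
      field_simp
      ring
    rw [hD, h4, h3]
    have hMp : 0 < M ^ p := by positivity
    calc _ = (T ^ (-β) * T ^ (((j : ℝ) - 1 / 2) * p)) / T * (M ^ p * (M ^ p)⁻¹) := by ring
      _ = _ := by rw [h5, mul_inv_cancel₀ hMp.ne']; field_simp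
  rw [lintegral_Ioi_eq_mul_lintegral_comp_mul_left hT0]
  have h6 : ∀ t ∈ Ioi (0 : ℝ), ENNReal.ofReal ((T * t) ^ s * |iteratedDeriv j h (T * t)| ^ p)
      = ENNReal.ofReal D * ENNReal.ofReal (t ^ s * |iteratedDeriv j g t| ^ p) := by
    intro t ht
    have hcT : 0 < c * T ^ j := by positivity
    rw [← ENNReal.ofReal_mul hD0.le, hgk, ← mul_assoc c, abs_mul (c * T ^ j), abs_of_pos hcT,
      Real.mul_rpow hcT.le (abs_nonneg _), Real.mul_rpow hT0.le (le_of_lt ht), ← hcoef]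
    congr 1
    ring
  rw [setLIntegral_congr_fun measurableSet_Ioi h6,
    lintegral_const_mul' _ _ ENNReal.ofReal_ne_top]
  calc _ ≤ ENNReal.ofReal T * (ENNReal.ofReal D * ENNReal.ofReal K) := by gcongr
    _ = _ := by
      rw [← ENNReal.ofReal_mul hD0.le, ← ENNReal.ofReal_mul hT0.le]
      congr 1
      rw [hD]
      field_simp

theorem exists_half_line_bound (n j : ℕ) (σ : ℝ) (hj : 0 < j) (hjn : j ≤ n) (hσ0 : 0 < σ)
    (hσ1 : ((n : ℝ) - 1) / 2 < σ) (hσ : σ < n) :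
    ∃ K : ℝ, 0 < K ∧ ∀ (h : ℝ → ℝ) (R M : ℝ), ContDiff ℝ (⊤ : ℕ∞) h → 0 ≤ M →
      (∀ t, 0 < t → |h t| ≤ M * √t) → (∀ t, R < t → iteratedDeriv j h t = 0) →
      ∫⁻ t in Ioi 0, ENNReal.ofReal (t ^ (2 * σ + 1 - (n + 1) / j)
          * |iteratedDeriv j h t| ^ (2 * (n + 1) / j : ℝ))
        ≤ ENNReal.ofReal (K * M ^ (2 * (n + 1) / j - 2 : ℝ)) *
          ∫⁻ t in Ioi 0, ENNReal.ofReal (t ^ (2 * σ) * iteratedDeriv (n + 1) h t ^ 2) := by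
  obtain ⟨K, hK, hmain⟩ := exists_scaled_bound n j σ hj hjn hσ0 hσ1 hσ
  refine ⟨K, hK, ?_⟩
  intro h R M hh hM hle hR
  have hj' : (0 : ℝ) < j := by exact_mod_cast hj
  rcases hM.eq_or_lt with rfl | hM
  · rw [setLIntegral_eq_zero measurableSet_Ioi]
    · exact zero_le
    intro t ht
    have h1 : h =ᶠ[nhds t] fun _ => 0 := by
      filter_upwards [Ioi_mem_nhds ht] with u hu
      simpa using hle u hu
    have h2 : iteratedDeriv j h t = 0 := by
      rw [h1.iteratedDeriv_eq j, iteratedDeriv_const]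
      simp
    have : (2 * ((n : ℝ) + 1) / j) ≠ 0 := by positivity
    simp [h2, Real.zero_rpow this]
  set B := ∫⁻ t in Ioi 0, ENNReal.ofReal (t ^ (2 * σ) * iteratedDeriv (n + 1) h t ^ 2) with hB
  set c : ℝ := K * M ^ (2 * (n + 1) / j - 2 : ℝ) with hc
  have hc0 : 0 < c := by positivity
  rcases eq_or_ne B ∞ with hBt | hBt
  · rw [hBt, ENNReal.mul_top (by simpa using hc0)]
    exact le_top
  refine ENNReal.le_of_forall_pos_le_add fun ε hε _ => ?_
  have hε' : (0 : ℝ) < ε := hε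
  have h1 := hmain h R M (B.toReal + ε / c) hh hM (by positivity) hle hR (by
    rw [ENNReal.ofReal_add ENNReal.toReal_nonneg (by positivity), ENNReal.ofReal_toReal hBt]
    exact le_self_add)
  refine h1.trans (le_of_eq ?_)
  rw [mul_add, mul_div_cancel₀ _ hc0.ne', ENNReal.ofReal_add (by positivity) hε'.le,
    ENNReal.ofReal_mul hc0.le, ENNReal.ofReal_toReal hBt, ENNReal.ofReal_coe_nnreal]

theorem measurableSet_HS (d : ℕ) : MeasurableSet (HS d) :=
  measurableSet_lt measurable_const (measurable_pi_apply _)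

theorem lintegral_HS_eq_lintegral_lines {d : ℕ} {v : Fin (d + 1) → ℝ} (hv : v (Fin.last d) = 1)
    {F : (Fin (d + 1) → ℝ) → ℝ≥0∞} (hF : Measurable F) :
    ∫⁻ x in HS d, F x = ∫⁻ y : Fin d → ℝ, ∫⁻ t in Ioi (0 : ℝ),
      F ((Fin.last d).insertNth (α := fun _ => ℝ) 0 y + t • v) := by
  set e := MeasurableEquiv.piFinSuccAbove (fun _ : Fin (d + 1) => ℝ) (Fin.last d) with he
  have hvol := volume_preserving_piFinSuccAbove (fun _ : Fin (d + 1) => ℝ) (Fin.last d)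
  set G := (HS d).indicator F with hG
  have hGm : Measurable G := hF.indicator (measurableSet_HS d)
  set v' : Fin d → ℝ := fun i => v ((Fin.last d).succAbove i) with hv'
  have hline : ∀ (y : Fin d → ℝ) (t : ℝ), e.symm (t, y + t • v')
      = (Fin.last d).insertNth (α := fun _ => ℝ) 0 y + t • v := by
    intro y t
    change (Fin.last d).insertNth (α := fun _ => ℝ) t (y + t • v') = _
    rw [Fin.insertNth_eq_iff]
    refine ⟨by simp [hv], ?_⟩
    ext i
    simp [Fin.removeNth, hv']
  have hGe : Measurable fun z : ℝ × (Fin d → ℝ) => G (e.symm z) := hGm.comp e.symm.measurable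
  have hshift : Measurable fun z : ℝ × (Fin d → ℝ) => G (e.symm (z.1, z.2 + z.1 • v')) := by
    refine hGe.comp (measurable_fst.prodMk ?_)
    exact measurable_snd.add (measurable_fst.smul_const v')
  calc ∫⁻ x in HS d, F x = ∫⁻ x, G x := (lintegral_indicator (measurableSet_HS d) F).symm
    _ = ∫⁻ z, G (e.symm z) := (hvol.symm.lintegral_comp hGm).symm
    _ = ∫⁻ t : ℝ, ∫⁻ y : Fin d → ℝ, G (e.symm (t, y)) :=
        lintegral_prod _ hGe.aemeasurable
    _ = ∫⁻ t : ℝ, ∫⁻ y : Fin d → ℝ, G (e.symm (t, y + t • v')) := by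
        congr 1
        ext t
        exact (lintegral_add_right_eq_self (fun y => G (e.symm (t, y))) (t • v')).symm
    _ = ∫⁻ y : Fin d → ℝ, ∫⁻ t : ℝ, G (e.symm (t, y + t • v')) :=
        lintegral_lintegral_swap hshift.aemeasurable
    _ = _ := by
        congr 1
        ext y
        rw [← lintegral_indicator measurableSet_Ioi]
        congr 1
        ext t
        rw [hline, hG]
        simp only [indicator, HS, Set.mem_ofPred_eq, mem_Ioi]
        simp [hv]

theorem iteratedDeriv_sub_const (g : ℝ → ℝ) (c : ℝ) {k : ℕ} (hk : 0 < k) :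
    iteratedDeriv k (fun t => g t - c) = iteratedDeriv k g := by
  obtain ⟨i, rfl⟩ := Nat.exists_eq_succ_of_ne_zero hk.ne'
  rw [Nat.succ_eq_add_one, iteratedDeriv_succ', iteratedDeriv_succ']
  congr 1
  ext t
  exact deriv_sub_const _

theorem exists_iteratedFDeriv_eq_zero_of_lt {d : ℕ} {f : (Fin (d + 1) → ℝ) → ℝ}
    (hf : HasCompactSupport f) (k : ℕ) :
    ∃ R : ℝ, ∀ x : Fin (d + 1) → ℝ, R < x (Fin.last d) → iteratedFDeriv ℝ k f x = 0 := by
  obtain ⟨R, hR⟩ := (hf.image (continuous_apply (Fin.last d))).bddAbove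
  refine ⟨R, fun x hx => ?_⟩
  by_contra hne
  have hx' : x ∈ tsupport f := support_iteratedFDeriv_subset k hne
  exact hx.not_ge (hR (mem_image_of_mem _ hx'))

theorem abs_sub_le_of_boundary_holder {d : ℕ} {f : (Fin (d + 1) → ℝ) → ℝ} {M : ℝ}
    (hf : Continuous f)
    (hM : ∀ x ∈ HS d, ∀ y ∈ HS d,
      |f x - f y| ≤ M * (√(x (Fin.last d)) + √(y (Fin.last d)) + √‖x - y‖))
    {v : Fin (d + 1) → ℝ} (hv : v (Fin.last d) = 1) {y : Fin (d + 1) → ℝ}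
    (hy : y (Fin.last d) = 0) {t : ℝ} (ht : 0 < t) :
    |f (y + t • v) - f y| ≤ M * (1 + √‖v‖) * √t := by
  have h1 : Filter.Tendsto (fun s : ℝ => |f (y + t • v) - f (y + s • v)|)
      (nhdsWithin 0 (Ioi 0)) (nhds (|f (y + t • v) - f (y + (0 : ℝ) • v)|)) :=
    (Continuous.tendsto (by fun_prop) _).mono_left nhdsWithin_le_nhds
  have h2 : Filter.Tendsto (fun s : ℝ => M * (√t + √s + √‖(t - s) • v‖))
      (nhdsWithin 0 (Ioi 0)) (nhds (M * (√t + √0 + √‖(t - 0) • v‖))) :=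
    (Continuous.tendsto (by fun_prop) _).mono_left nhdsWithin_le_nhds
  have h3 := le_of_tendsto_of_tendsto h1 h2 (by
    filter_upwards [self_mem_nhdsWithin] with s hs
    have := hM (y + t • v) (by simpa [HS, hy, hv] using ht) (y + s • v)
      (by simpa [HS, hy, hv] using hs)
    simpa [hy, hv, sub_smul] using this)
  rw [zero_smul, add_zero] at h3
  refine h3.trans (le_of_eq ?_)
  rw [sub_zero, Real.sqrt_zero, norm_smul, Real.norm_of_nonneg ht.le, Real.sqrt_mul ht.le]
  ring

theorem exists_directional_bound (d n j : ℕ) (σ : ℝ) (hj : 0 < j) (hjn : j ≤ n) (hσ0 : 0 < σ)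
    (hσ1 : ((n : ℝ) - 1) / 2 < σ) (hσ : σ < n) {v : Fin (d + 1) → ℝ}
    (hv : v (Fin.last d) = 1) :
    ∃ K : ℝ, 0 < K ∧ ∀ (f : (Fin (d + 1) → ℝ) → ℝ) (M : ℝ), 0 ≤ M →
      ContDiff ℝ (⊤ : ℕ∞) f → HasCompactSupport f →
      (∀ x ∈ HS d, ∀ y ∈ HS d,
        |f x - f y| ≤ M * (√(x (Fin.last d)) + √(y (Fin.last d)) + √‖x - y‖)) →
      ∫⁻ x in HS d, ENNReal.ofReal (x (Fin.last d) ^ (2 * σ + 1 - (n + 1) / j)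
          * |iteratedFDeriv ℝ j f x (fun _ => v)| ^ (2 * (n + 1) / j : ℝ))
        ≤ ENNReal.ofReal (K * M ^ (2 * (n + 1) / j - 2 : ℝ)) *
          ∫⁻ x in HS d, ENNReal.ofReal (x (Fin.last d) ^ (2 * σ)
            * iteratedFDeriv ℝ (n + 1) f x (fun _ => v) ^ 2) := by
  obtain ⟨K, hK, hmain⟩ := exists_half_line_bound n j σ hj hjn hσ0 hσ1 hσ
  set q : ℝ := 2 * (n + 1) / j - 2 with hq
  refine ⟨K * (1 + √‖v‖) ^ q, by positivity, ?_⟩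
  intro f M hM hf hfc hfM
  have hk : ∀ k : ℕ, Continuous fun x => iteratedFDeriv ℝ k f x (fun _ => v) := fun k =>
    (hf.continuous_iteratedFDeriv (mod_cast le_top)).eval_const _
  have hk' : ∀ k : ℕ, Measurable fun x => iteratedFDeriv ℝ k f x (fun _ => v) :=
    fun k => (hk k).measurable
  have hlast : Measurable fun x : Fin (d + 1) → ℝ => x (Fin.last d) := measurable_pi_apply _
  rw [lintegral_HS_eq_lintegral_lines hv, lintegral_HS_eq_lintegral_lines hv]
  rotate_left
  · exact ((hlast.pow_const _).mul ((hk' _).pow_const _)).ennreal_ofReal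
  · exact ((hlast.pow_const _).mul ((hk' _).abs.pow_const _)).ennreal_ofReal
  rw [← lintegral_const_mul' _ _ ENNReal.ofReal_ne_top]
  refine lintegral_mono fun y => ?_
  set z : Fin (d + 1) → ℝ := (Fin.last d).insertNth (α := fun _ => ℝ) 0 y with hz
  have hz0 : z (Fin.last d) = 0 := by simp [hz]
  have hzt : ∀ t : ℝ, (z + t • v) (Fin.last d) = t := fun t => by simp [hz0, hv]
  have hder : ∀ k : ℕ, 0 < k → iteratedDeriv k (fun t : ℝ => f (z + t • v) - f z)
      = fun t => iteratedFDeriv ℝ k f (z + t • v) (fun _ => v) := fun k hk0 => by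
    rw [iteratedDeriv_sub_const (fun t : ℝ => f (z + t • v)) _ hk0,
      iteratedDeriv_comp_add_smul hf]
  obtain ⟨R, hR⟩ := exists_iteratedFDeriv_eq_zero_of_lt hfc j
  have hhs : ContDiff ℝ (⊤ : ℕ∞) fun t : ℝ => f (z + t • v) - f z := by
    have : ContDiff ℝ (⊤ : ℕ∞) fun t : ℝ => z + t • v := by fun_prop
    exact (hf.comp this).sub contDiff_const
  have h1 := hmain (fun t => f (z + t • v) - f z) R (M * (1 + √‖v‖)) hhs (by positivity)
    (fun t ht => abs_sub_le_of_boundary_holder hf.continuous hfM hv hz0 ht)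
    (fun t ht => by
      rw [hder j hj]
      simp [hR (z + t • v) (by rwa [hzt])])
  simp only [hder j hj, hder (n + 1) n.succ_pos] at h1
  simp only [hzt]
  rw [Real.mul_rpow hM (by positivity)] at h1
  convert h1 using 3
  ring

theorem exists_directions_norm_le (d j : ℕ) :
    ∃ (W : Finset (Fin (d + 1) → ℝ)) (L : ℝ), 0 < L ∧ (∀ v ∈ W, v (Fin.last d) = 1) ∧
      ∀ A : ContinuousMultilinearMap ℝ (fun _ : Fin j => Fin (d + 1) → ℝ) ℝ,
        (∀ (v : Fin j → Fin (d + 1) → ℝ) (τ : Equiv.Perm (Fin j)), A (v ∘ τ) = A v) →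
        ‖A‖ ≤ L * ∑ v ∈ W, |A (fun _ => v)| := by
  classical
  obtain ⟨V, hV⟩ : ∃ V : (Fin j → Fin (d + 1)) × Finset (Fin j) → Fin (d + 1) → ℝ,
      ∀ q, V q = Pi.single (Fin.last d) 1 + ∑ i ∈ q.2, Pi.single (q.1 i) 1 := ⟨_, fun _ => rfl⟩
  obtain ⟨c, hc⟩ : ∃ c : (Fin j → Fin (d + 1)) × Finset (Fin j) → ℝ,
      ∀ q, c q = V q (Fin.last d) := ⟨_, fun _ => rfl⟩
  have hc1 : ∀ q, 1 ≤ c q := by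
    intro q
    simp only [hc, hV, Pi.add_apply, Finset.sum_apply, Pi.single_eq_same]
    refine le_add_of_nonneg_right (Finset.sum_nonneg fun i _ => ?_)
    rw [Pi.single_apply]
    split_ifs <;> norm_num
  have hc0 : ∀ q, 0 < c q := fun q => one_pos.trans_le (hc1 q)
  obtain ⟨N, hN⟩ : ∃ N : (Fin j → Fin (d + 1)) × Finset (Fin j) → Fin (d + 1) → ℝ,
      ∀ q, N q = (c q)⁻¹ • V q := ⟨_, fun _ => rfl⟩
  refine ⟨Finset.univ.image N, ∑ q, c q ^ j, ?_, ?_, ?_⟩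
  · exact Finset.sum_pos (fun q _ => pow_pos (hc0 q) _)
      ⟨(fun _ => Fin.last d, ∅), Finset.mem_univ _⟩
  · intro v hv
    obtain ⟨q, -, rfl⟩ := Finset.mem_image.1 hv
    rw [hN, Pi.smul_apply, smul_eq_mul, ← hc, inv_mul_cancel₀ (hc0 q).ne']
  intro A hA
  have hscale : ∀ q, |A (fun _ => V q)| = c q ^ j * |A (fun _ => N q)| := by
    intro q
    have h1 : (fun _ : Fin j => V q) = fun _ => c q • N q := by
      ext i : 1
      rw [hN, smul_smul, mul_inv_cancel₀ (hc0 q).ne', one_smul]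
    rw [h1, A.map_smul_univ (fun _ => c q) (fun _ => N q)]
    simp [abs_mul, abs_of_pos (hc0 q)]
  have hbasis : ∀ φ : Fin j → Fin (d + 1), |A (fun i => Pi.single (φ i) 1)|
      ≤ ∑ S : Finset (Fin j), |A (fun _ => V (φ, S))| := by
    intro φ
    have h1 := symmetric_multilinear_polarization A hA (Pi.single (Fin.last d) 1)
      (fun i => Pi.single (φ i) 1)
    have h2 : |A (fun i => Pi.single (φ i) 1)|
        ≤ |(-1) ^ j * (j.factorial * A (fun i => Pi.single (φ i) 1))| := by
      rw [abs_mul, abs_pow, abs_neg, abs_one, one_pow, one_mul, abs_mul, Nat.abs_cast]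
      exact le_mul_of_one_le_left (abs_nonneg _) (mod_cast j.factorial_pos)
    refine h2.trans ?_
    rw [← h1]
    simp only [hV]
    refine (Finset.abs_sum_le_sum_abs _ _).trans (Finset.sum_le_sum fun S _ => ?_)
    rw [abs_mul, abs_pow, abs_neg, abs_one, one_pow, one_mul]
  have hterm : ∀ q, |A (fun _ => V q)| ≤ c q ^ j * ∑ v ∈ Finset.univ.image N, |A (fun _ => v)| := by
    intro q
    rw [hscale]
    refine mul_le_mul_of_nonneg_left ?_ (pow_nonneg (hc0 q).le _)
    exact Finset.single_le_sum (f := fun v => |A (fun _ => v)|) (fun _ _ => abs_nonneg _)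
      (Finset.mem_image_of_mem N (Finset.mem_univ q))
  rw [Finset.sum_mul]
  refine le_trans ?_ (Finset.sum_le_sum fun q _ => hterm q)
  rw [Fintype.sum_prod_type]
  exact (opNorm_le_sum_basis A).trans (Finset.sum_le_sum fun φ _ => hbasis φ)

theorem wLp_ofReal_eq {d : ℕ} (σ : ℝ) {p : ℝ} (hp : 0 < p) {g : (Fin (d + 1) → ℝ) → ℝ}
    (hg : ∀ x, 0 ≤ g x) :
    wLp d σ (ENNReal.ofReal p) g
      = (∫⁻ x in HS d, ENNReal.ofReal (x (Fin.last d) ^ (σ * p) * g x ^ p)) ^ (1 / p) := by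
  rw [wLp, eLpNorm_eq_lintegral_rpow_enorm_toReal (by simpa using hp) ENNReal.ofReal_ne_top,
    ENNReal.toReal_ofReal hp.le]
  congr 1
  refine setLIntegral_congr_fun (measurableSet_HS d) fun x hx => ?_
  have hx0 : 0 < x (Fin.last d) := hx
  have hgx := hg x
  rw [Real.enorm_of_nonneg (by positivity), ENNReal.ofReal_rpow_of_nonneg (by positivity) hp.le,
    Real.mul_rpow (by positivity) hgx, Real.rpow_mul hx0.le]

theorem exists_lintegral_iteratedFDeriv_bound (d n j : ℕ) (σ : ℝ) (hj : 0 < j) (hjn : j ≤ n)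
    (hσ0 : 0 < σ) (hσ1 : ((n : ℝ) - 1) / 2 < σ) (hσ : σ < n) :
    ∃ K : ℝ, 0 < K ∧ ∀ (f : (Fin (d + 1) → ℝ) → ℝ) (M : ℝ), 0 ≤ M →
      ContDiff ℝ (⊤ : ℕ∞) f → HasCompactSupport f →
      (∀ x ∈ HS d, ∀ y ∈ HS d,
        |f x - f y| ≤ M * (√(x (Fin.last d)) + √(y (Fin.last d)) + √‖x - y‖)) →
      ∫⁻ x in HS d, ENNReal.ofReal (x (Fin.last d) ^ (2 * σ + 1 - (n + 1) / j)
          * ‖iteratedFDeriv ℝ j f x‖ ^ (2 * (n + 1) / j : ℝ))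
        ≤ ENNReal.ofReal (K * M ^ (2 * (n + 1) / j - 2 : ℝ)) *
          ∫⁻ x in HS d, ENNReal.ofReal (x (Fin.last d) ^ (2 * σ)
            * ‖iteratedFDeriv ℝ (n + 1) f x‖ ^ 2) := by
  classical
  obtain ⟨W, L, hL, hW, hAW⟩ := exists_directions_norm_le d j
  have hdir : ∀ v : Fin (d + 1) → ℝ, ∃ K : ℝ, 0 < K ∧ (v ∈ W →
      ∀ (f : (Fin (d + 1) → ℝ) → ℝ) (M : ℝ), 0 ≤ M →
      ContDiff ℝ (⊤ : ℕ∞) f → HasCompactSupport f →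
      (∀ x ∈ HS d, ∀ y ∈ HS d,
        |f x - f y| ≤ M * (√(x (Fin.last d)) + √(y (Fin.last d)) + √‖x - y‖)) →
      ∫⁻ x in HS d, ENNReal.ofReal (x (Fin.last d) ^ (2 * σ + 1 - (n + 1) / j)
          * |iteratedFDeriv ℝ j f x (fun _ => v)| ^ (2 * (n + 1) / j : ℝ))
        ≤ ENNReal.ofReal (K * M ^ (2 * (n + 1) / j - 2 : ℝ)) *
          ∫⁻ x in HS d, ENNReal.ofReal (x (Fin.last d) ^ (2 * σ)
            * iteratedFDeriv ℝ (n + 1) f x (fun _ => v) ^ 2)) := by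
    intro v
    by_cases hv : v ∈ W
    · obtain ⟨K, hK, h⟩ := exists_directional_bound d n j σ hj hjn hσ0 hσ1 hσ (hW v hv)
      exact ⟨K, hK, fun _ => h⟩
    · exact ⟨1, one_pos, fun h => absurd h hv⟩
  choose κ hκ0 hκ using hdir
  have hj' : (0 : ℝ) < j := by exact_mod_cast hj
  have hjn' : (j : ℝ) ≤ n := by exact_mod_cast hjn
  set p : ℝ := 2 * (n + 1) / j with hp
  have hp1 : 1 ≤ p := by
    rw [hp, le_div_iff₀ hj']
    linarith
  set s : ℝ := 2 * σ + 1 - (n + 1) / j with hs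
  set P : ℝ := L ^ p * (W.card : ℝ) ^ (p - 1) with hP
  have hP0 : 0 ≤ P := by positivity
  set Q : ℝ := ∑ v ∈ W, κ v * (‖v‖ ^ (n + 1)) ^ 2 with hQ
  have hQ0 : 0 ≤ Q := Finset.sum_nonneg fun v _ => mul_nonneg (hκ0 v).le (by positivity)
  refine ⟨P * Q + 1, by positivity, ?_⟩
  intro f M hM hf hfc hfM
  have hlast : Measurable fun x : Fin (d + 1) → ℝ => x (Fin.last d) := measurable_pi_apply _
  have hk : ∀ (k : ℕ) (v : Fin (d + 1) → ℝ),
      Measurable fun x => iteratedFDeriv ℝ k f x (fun _ => v) := fun k v =>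
    ((hf.continuous_iteratedFDeriv (mod_cast le_top)).eval_const _).measurable
  set B := ∫⁻ x in HS d, ENNReal.ofReal (x (Fin.last d) ^ (2 * σ)
            * ‖iteratedFDeriv ℝ (n + 1) f x‖ ^ 2) with hB
  have hpt : ∀ x ∈ HS d, ENNReal.ofReal (x (Fin.last d) ^ s * ‖iteratedFDeriv ℝ j f x‖ ^ p)
      ≤ ENNReal.ofReal P * ∑ v ∈ W, ENNReal.ofReal (x (Fin.last d) ^ s
        * |iteratedFDeriv ℝ j f x (fun _ => v)| ^ p) := by
    intro x hx
    have hx0 : 0 < x (Fin.last d) := hx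
    have h1 := hAW (iteratedFDeriv ℝ j f x) (iteratedFDeriv_apply_comp_perm hf j x)
    have h2 : ‖iteratedFDeriv ℝ j f x‖ ^ p
        ≤ P * ∑ v ∈ W, |iteratedFDeriv ℝ j f x (fun _ => v)| ^ p := by
      calc _ ≤ (L * ∑ v ∈ W, |iteratedFDeriv ℝ j f x (fun _ => v)|) ^ p := by gcongr
        _ = L ^ p * (∑ v ∈ W, |iteratedFDeriv ℝ j f x (fun _ => v)|) ^ p :=
          Real.mul_rpow hL.le (Finset.sum_nonneg fun _ _ => abs_nonneg _)
        _ ≤ L ^ p * ((W.card : ℝ) ^ (p - 1)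
            * ∑ v ∈ W, |iteratedFDeriv ℝ j f x (fun _ => v)| ^ p) := by
          gcongr
          exact Real.rpow_sum_le_const_mul_sum_rpow_of_nonneg _ hp1 fun _ _ => abs_nonneg _
        _ = _ := by rw [hP]; ring
    rw [← ENNReal.ofReal_sum_of_nonneg (fun _ _ => by positivity), ← ENNReal.ofReal_mul hP0]
    apply ENNReal.ofReal_le_ofReal
    rw [← Finset.mul_sum]
    calc _ ≤ x (Fin.last d) ^ s
          * (P * ∑ v ∈ W, |iteratedFDeriv ℝ j f x (fun _ => v)| ^ p) := by gcongr
      _ = _ := by ring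
  have hv : ∀ v ∈ W, ∫⁻ x in HS d, ENNReal.ofReal (x (Fin.last d) ^ s
        * |iteratedFDeriv ℝ j f x (fun _ => v)| ^ p)
      ≤ ENNReal.ofReal (κ v * (‖v‖ ^ (n + 1)) ^ 2) * (ENNReal.ofReal (M ^ (p - 2)) * B) := by
    intro v hvW
    refine (hκ v hvW f M hM hf hfc hfM).trans ?_
    have h1 : ∫⁻ x in HS d, ENNReal.ofReal (x (Fin.last d) ^ (2 * σ)
            * iteratedFDeriv ℝ (n + 1) f x (fun _ => v) ^ 2)
        ≤ ENNReal.ofReal ((‖v‖ ^ (n + 1)) ^ 2) * B := by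
      rw [hB, ← lintegral_const_mul' _ _ ENNReal.ofReal_ne_top]
      refine setLIntegral_mono' (measurableSet_HS d) fun x hx => ?_
      have hx0 : 0 < x (Fin.last d) := hx
      rw [← ENNReal.ofReal_mul (by positivity)]
      apply ENNReal.ofReal_le_ofReal
      have h2 := (iteratedFDeriv ℝ (n + 1) f x).le_opNorm (fun _ => v)
      rw [Finset.prod_const, Finset.card_univ, Fintype.card_fin, Real.norm_eq_abs] at h2
      rw [← sq_abs (iteratedFDeriv ℝ (n + 1) f x fun _ => v)]
      calc _ ≤ x (Fin.last d) ^ (2 * σ)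
            * (‖iteratedFDeriv ℝ (n + 1) f x‖ * ‖v‖ ^ (n + 1)) ^ 2 := by gcongr
        _ = _ := by ring
    calc _ ≤ ENNReal.ofReal (κ v * M ^ (p - 2)) * (ENNReal.ofReal ((‖v‖ ^ (n + 1)) ^ 2) * B) := by
          gcongr
      _ = _ := by
        rw [ENNReal.ofReal_mul (hκ0 v).le, ENNReal.ofReal_mul (hκ0 v).le]
        ring
  calc _ ≤ ∫⁻ x in HS d, ENNReal.ofReal P * ∑ v ∈ W, ENNReal.ofReal (x (Fin.last d) ^ s
        * |iteratedFDeriv ℝ j f x (fun _ => v)| ^ p) :=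
        setLIntegral_mono' (measurableSet_HS d) hpt
    _ = ENNReal.ofReal P * ∑ v ∈ W, ∫⁻ x in HS d, ENNReal.ofReal (x (Fin.last d) ^ s
        * |iteratedFDeriv ℝ j f x (fun _ => v)| ^ p) := by
        rw [lintegral_const_mul' _ _ ENNReal.ofReal_ne_top, lintegral_finsetSum]
        exact fun v _ => ((hlast.pow_const _).mul ((hk _ v).abs.pow_const _)).ennreal_ofReal
    _ ≤ ENNReal.ofReal P * ∑ v ∈ W, ENNReal.ofReal (κ v * (‖v‖ ^ (n + 1)) ^ 2)
          * (ENNReal.ofReal (M ^ (p - 2)) * B) := by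
        gcongr with v hvW
        exact hv v hvW
    _ = ENNReal.ofReal (P * Q * M ^ (p - 2)) * B := by
        rw [← Finset.sum_mul, ← ENNReal.ofReal_sum_of_nonneg
          (fun v _ => mul_nonneg (hκ0 v).le (by positivity)),
          ENNReal.ofReal_mul (p := P * Q) (by positivity), ENNReal.ofReal_mul (p := P) hP0]
        ring
    _ ≤ _ := by
        gcongr
        linarith

/-- **Weighted interpolation against the boundary-adapted `C̃^{1/2}` norm**
(Proposition 2.8): with `θ_j = j/m`, `σ_j = σ_m θ_j − (1−θ_j)/2`, `1/p_j = θ_j/2`, under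
`σ_m > (m−2)/2` and `m − 1/2 − σ_m − d/2 > 0`, whenever `M` bounds the `C̃^{1/2}` norm of
`f` on `H`, `‖x_d^{σ_j} ∂^j f‖_{L^{p_j}} ≲ M^{1−θ_j} ‖x_d^{σ_m} ∂^m f‖_{L²}^{θ_j}`. -/
theorem weighted_interpolation_boundary_holder
    (d m j : ℕ) (σm : ℝ)
    (hm : 2 ≤ m) (hj : 0 < j) (hjm : j < m)
    (hσm : ((m : ℝ) - 2) / 2 < σm)
    (hmain : (m : ℝ) - 1 / 2 - σm - (d + 1 : ℝ) / 2 > 0) :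
    ∃ C : ℝ, 0 < C ∧
      ∀ (f : (Fin (d + 1) → ℝ) → ℝ) (M : ℝ), 0 ≤ M →
        ContDiff ℝ (⊤ : ℕ∞) f → HasCompactSupport f →
        (∀ x ∈ HS d, ∀ y ∈ HS d,
          |f x - f y| ≤ M * (Real.sqrt (x (Fin.last d)) + Real.sqrt (y (Fin.last d))
            + Real.sqrt ‖x - y‖)) →
        wLp d (σm * ((j : ℝ) / m) - (1 - (j : ℝ) / m) / 2)
            (ENNReal.ofReal (2 * (m : ℝ) / j))
            (fun x => ‖iteratedFDeriv ℝ j f x‖)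
          ≤ ENNReal.ofReal C
              * ENNReal.ofReal M ^ (1 - (j : ℝ) / m)
              * wLp d σm 2 (fun x => ‖iteratedFDeriv ℝ m f x‖) ^ ((j : ℝ) / m) := by
  obtain ⟨n, rfl⟩ : ∃ n, m = n + 1 := ⟨m - 1, by omega⟩
  have hn : (1 : ℝ) ≤ n := by exact_mod_cast (by omega : 1 ≤ n)
  push_cast at hσm hmain ⊢
  have hd : (0 : ℝ) ≤ d := d.cast_nonneg
  obtain ⟨K, hK, hbd⟩ := exists_lintegral_iteratedFDeriv_bound d n j σm hj (by omega)
    (by linarith) (by linarith) (by linarith)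
  have hj' : (0 : ℝ) < j := by exact_mod_cast hj
  have hjn : (j : ℝ) < n + 1 := by exact_mod_cast hjm
  set p : ℝ := 2 * (n + 1) / j with hp
  have hp0 : 0 < p := by positivity
  refine ⟨K ^ (1 / p), by positivity, ?_⟩
  intro f M hM hf hfc hfM
  have h2 : (2 : ℝ≥0∞) = ENNReal.ofReal 2 := by simp
  rw [h2, wLp_ofReal_eq _ hp0 fun _ => norm_nonneg _,
    wLp_ofReal_eq _ two_pos fun _ => norm_nonneg _]
  have hs : (σm * ((j : ℝ) / (n + 1)) - (1 - (j : ℝ) / (n + 1)) / 2) * p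
      = 2 * σm + 1 - (n + 1) / j := by
    rw [hp]
    field_simp
    ring
  have hq : (p - 2) * (1 / p) = 1 - (j : ℝ) / (n + 1) := by
    rw [hp]
    field_simp
  have hr : 1 / 2 * ((j : ℝ) / (n + 1)) = 1 / p := by
    rw [hp]
    field_simp
  have hp2 : 0 ≤ p - 2 := by
    rw [hp, sub_nonneg, le_div_iff₀ hj']
    linarith
  simp only [Real.rpow_two]
  rw [hs, ← ENNReal.rpow_mul, hr, mul_comm σm 2]
  refine (ENNReal.rpow_le_rpow (hbd f M hM hf hfc hfM) (by positivity)).trans (le_of_eq ?_)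
  rw [ENNReal.mul_rpow_of_nonneg _ _ (by positivity), ENNReal.ofReal_mul hK.le,
    ENNReal.mul_rpow_of_nonneg _ _ (by positivity),
    ENNReal.ofReal_rpow_of_nonneg hK.le (by positivity),
    ← ENNReal.ofReal_rpow_of_nonneg hM hp2, ← ENNReal.rpow_mul, hq]
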